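/- (Carleman estimate for the linear KdV operator with internal observation.) Let 0 < l1 < l2 < L, T > 0, and let (ψ, l3) satisfy conditions (C1)–(C5); set φ(t,x) = ψ(x)/(t(T−t)). Then there exist constants C > 0 and s0 > 0 such that for every s ≥ s0 and every q ∈ C^∞([0,T]×[0,L]) satisfying q(t,0) = q(t,L) = q_x(t,L) = 0 for all t ∈ [0,T], setting f := q_t + q_xxx, one has: ∫₀^T∫₀^L [ sφ q_xx² + (sφ)³ q_x² + (sφ)⁵ q² ] e^{−2sφ} dx dt + ∫₀^T [ (sφ q_xx² + (sφ)³ q_x²) e^{−2sφ} ]|_{x=0} dt + ∫₀^T [ sφ q_xx² e^{−2sφ} ]|_{x=L} dt ≤ C ( ∫₀^T∫₀^L f² e^{−2sφ} dx dt + ∫₀^T∫_{l1}^{l2} [ sφ q_xx² + (sφ)³ q_x² + (sφ)⁵ q² ] e^{−2sφ} dx dt ). -/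

import Mathlib

/-- Partial derivative in the space variable (second argument). -/
noncomputable def pdx (f : ℝ → ℝ → ℝ) : ℝ → ℝ → ℝ := fun t x => deriv (f t) x

/-- Partial derivative in the time variable (first argument). -/
noncomputable def pdt (f : ℝ → ℝ → ℝ) : ℝ → ℝ → ℝ := fun t x => deriv (fun s => f s x) t

namespace KdVCarleman

open MeasureTheory Set Filter Topology

section PartialDerivatives

variable {q : ℝ → ℝ → ℝ}

lemma hasDerivAt_snd_fderiv {n : WithTop ℕ∞} (hq : ContDiff ℝ n (Function.uncurry q))
    (hn : n ≠ 0) (t x : ℝ) :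
    HasDerivAt (q t) (fderiv ℝ (Function.uncurry q) (t, x) (0, 1)) x := by
  have h := (hq.differentiable hn (t, x)).hasFDerivAt
  have hc : HasDerivAt (fun y : ℝ => (t, y)) ((0 : ℝ), (1 : ℝ)) x :=
    (hasDerivAt_const x t).prodMk (hasDerivAt_id x)
  exact h.comp_hasDerivAt x hc

lemma hasDerivAt_fst_fderiv {n : WithTop ℕ∞} (hq : ContDiff ℝ n (Function.uncurry q))
    (hn : n ≠ 0) (t x : ℝ) :
    HasDerivAt (fun τ => q τ x) (fderiv ℝ (Function.uncurry q) (t, x) (1, 0)) t := by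
  have h := (hq.differentiable hn (t, x)).hasFDerivAt
  have hc : HasDerivAt (fun y : ℝ => (y, x)) ((1 : ℝ), (0 : ℝ)) t :=
    (hasDerivAt_id t).prodMk (hasDerivAt_const t x)
  exact h.comp_hasDerivAt t hc

lemma uncurry_pdx (hq : ContDiff ℝ (⊤ : ℕ∞) (Function.uncurry q)) :
    Function.uncurry (pdx q) = fun p => fderiv ℝ (Function.uncurry q) p (0, 1) := by
  ext ⟨t, x⟩
  exact (hasDerivAt_snd_fderiv hq (by simp) t x).deriv

lemma uncurry_pdt (hq : ContDiff ℝ (⊤ : ℕ∞) (Function.uncurry q)) :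
    Function.uncurry (pdt q) = fun p => fderiv ℝ (Function.uncurry q) p (1, 0) := by
  ext ⟨t, x⟩
  exact (hasDerivAt_fst_fderiv hq (by simp) t x).deriv

lemma contDiff_pdx (hq : ContDiff ℝ (⊤ : ℕ∞) (Function.uncurry q)) :
    ContDiff ℝ (⊤ : ℕ∞) (Function.uncurry (pdx q)) := by
  rw [uncurry_pdx hq]
  exact (hq.fderiv_right (m := (⊤ : ℕ∞)) (by simp)).clm_apply contDiff_const

lemma contDiff_pdt (hq : ContDiff ℝ (⊤ : ℕ∞) (Function.uncurry q)) :
    ContDiff ℝ (⊤ : ℕ∞) (Function.uncurry (pdt q)) := by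
  rw [uncurry_pdt hq]
  exact (hq.fderiv_right (m := (⊤ : ℕ∞)) (by simp)).clm_apply contDiff_const

lemma hasDerivAt_pdx (hq : ContDiff ℝ (⊤ : ℕ∞) (Function.uncurry q)) (t x : ℝ) :
    HasDerivAt (q t) (pdx q t x) x :=
  (hasDerivAt_snd_fderiv hq (by simp) t x).differentiableAt.hasDerivAt

lemma hasDerivAt_pdt (hq : ContDiff ℝ (⊤ : ℕ∞) (Function.uncurry q)) (t x : ℝ) :
    HasDerivAt (fun τ => q τ x) (pdt q t x) t :=
  (hasDerivAt_fst_fderiv hq (by simp) t x).differentiableAt.hasDerivAt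

lemma pdt_pdx_comm (hq : ContDiff ℝ (⊤ : ℕ∞) (Function.uncurry q)) (t x : ℝ) :
    pdt (pdx q) t x = pdx (pdt q) t x := by
  have hsymm : IsSymmSndFDerivAt ℝ (Function.uncurry q) (t, x) :=
    hq.contDiffAt.isSymmSndFDerivAt (by
      rw [minSmoothness_of_isRCLikeNormedField]; exact WithTop.coe_le_coe.2 (le_top : (2 : ℕ∞) ≤ ⊤))
  have hd : DifferentiableAt ℝ (fderiv ℝ (Function.uncurry q)) (t, x) :=
    (hq.fderiv_right (m := (⊤ : ℕ∞)) (by simp)).differentiable (by simp) _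
  have key : ∀ v w : ℝ × ℝ, fderiv ℝ (fun p => fderiv ℝ (Function.uncurry q) p v) (t, x) w
      = fderiv ℝ (fderiv ℝ (Function.uncurry q)) (t, x) w v := fun v w => by
    rw [fderiv_clm_apply hd (differentiableAt_const v)]
    simp
  have h1 : pdt (pdx q) t x
      = fderiv ℝ (Function.uncurry (pdx q)) (t, x) (1, 0) :=
    (hasDerivAt_fst_fderiv (contDiff_pdx hq) (by simp) t x).deriv
  have h2 : pdx (pdt q) t x
      = fderiv ℝ (Function.uncurry (pdt q)) (t, x) (0, 1) :=
    (hasDerivAt_snd_fderiv (contDiff_pdt hq) (by simp) t x).deriv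
  rw [h1, h2, uncurry_pdx hq, uncurry_pdt hq, key, key]
  exact hsymm _ _

end PartialDerivatives

section ParametricIntegral

/-- Differentiation under the integral sign over a compact interval. -/
lemma hasDerivAt_intervalIntegral_of_continuousOn {F F' : ℝ → ℝ → ℝ} {U : Set ℝ} {a b t : ℝ}
    (hU : IsOpen U) (ht : t ∈ U)
    (hF : ∀ τ ∈ U, Continuous (F τ))
    (hF' : ContinuousOn (Function.uncurry F') (U ×ˢ univ))
    (hderiv : ∀ τ ∈ U, ∀ x, HasDerivAt (fun r => F r x) (F' τ x) τ) :
    HasDerivAt (fun τ => ∫ x in a..b, F τ x) (∫ x in a..b, F' t x) t := by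
  obtain ⟨ε, hε, hεU⟩ := Metric.isOpen_iff.1 hU t ht
  have hsub : Metric.closedBall t (ε / 2) ⊆ U :=
    (Metric.closedBall_subset_ball (by linarith)).trans hεU
  have hK : IsCompact (Metric.closedBall t (ε / 2) ×ˢ uIcc a b) :=
    (isCompact_closedBall _ _).prod isCompact_uIcc
  obtain ⟨M, hM⟩ := hK.exists_bound_of_continuousOn
    (hF'.mono (prod_mono hsub (subset_univ _)))
  have hnhds : Metric.closedBall t (ε / 2) ∈ 𝓝 t := Metric.closedBall_mem_nhds _ (by linarith)
  have hF't : Continuous (F' t) := by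
    have : ContinuousOn (fun x => Function.uncurry F' (t, x)) univ :=
      hF'.comp (by fun_prop) (fun x _ => ⟨ht, mem_univ _⟩)
    exact continuousOn_univ.1 this
  refine (intervalIntegral.hasDerivAt_integral_of_dominated_loc_of_deriv_le (bound := fun _ => M)
    hnhds ?_ ((hF t ht).intervalIntegrable _ _) hF't.aestronglyMeasurable ?_
    intervalIntegrable_const ?_).2
  · filter_upwards [hU.mem_nhds ht] with τ hτ
    exact (hF τ hτ).aestronglyMeasurable
  · exact .of_forall fun x hx τ hτ => hM (τ, x) ⟨hτ, uIoc_subset_uIcc hx⟩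
  · exact .of_forall fun x _ τ hτ => hderiv τ (hsub hτ) x

end ParametricIntegral

section Pointwise

/-- The Carleman energy density of the jet `(u₀, u₁, u₂)` with parameter `l`. -/
def energy (l u0 u1 u2 : ℝ) : ℝ := l * u2 ^ 2 + l ^ 3 * u1 ^ 2 + l ^ 5 * u0 ^ 2

/-- The spatial flux in the Carleman identity. -/
noncomputable def flux (a1 a2 u0 u1 u2 ut : ℝ) : ℝ :=
  3 * a1 * u1 * ut + 3 / 2 * a1 * u2 ^ 2 + 3 * a2 * u1 * u2 + a1 ^ 3 * u0 * u2
    + 6 * a1 ^ 2 * a2 * u0 * u1 + 4 * a1 ^ 3 * u1 ^ 2 + 3 / 2 * a1 ^ 5 * u0 ^ 2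

/-- The space derivative of `flux`. -/
noncomputable def fluxDeriv (a1 a2 a3 u0 u1 u2 u3 ut utx : ℝ) : ℝ :=
  3 * a2 * u1 * ut + 3 * a1 * u2 * ut + 3 * a1 * u1 * utx + 3 / 2 * a2 * u2 ^ 2
    + 3 * a1 * u2 * u3 + 3 * a3 * u1 * u2 + 3 * a2 * u2 ^ 2 + 3 * a2 * u1 * u3
    + 3 * a1 ^ 2 * a2 * u0 * u2 + a1 ^ 3 * u1 * u2 + a1 ^ 3 * u0 * u3
    + 6 * (2 * a1 * a2 ^ 2 + a1 ^ 2 * a3) * u0 * u1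
    + 6 * a1 ^ 2 * a2 * (u1 ^ 2 + u0 * u2) + 12 * a1 ^ 2 * a2 * u1 ^ 2
    + 8 * a1 ^ 3 * u1 * u2 + 15 / 2 * a1 ^ 4 * a2 * u0 ^ 2 + 3 * a1 ^ 5 * u0 * u1

/-- The time density in the Carleman identity. -/
noncomputable def density (a1 u0 u1 : ℝ) : ℝ :=
  -3 / 2 * a1 * u1 ^ 2 + 1 / 2 * a1 ^ 3 * u0 ^ 2

/-- The time derivative of `density`. -/
noncomputable def densityDeriv (a1 a1t u0 u1 ut utx : ℝ) : ℝ :=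
  -3 / 2 * a1t * u1 ^ 2 - 3 * a1 * u1 * utx + 3 / 2 * a1 ^ 2 * a1t * u0 ^ 2 + a1 ^ 3 * u0 * ut

lemma hasDerivAt_flux {a1 a2 u0 u1 u2 ut : ℝ → ℝ} {a3 u3 utx x : ℝ}
    (ha1 : HasDerivAt a1 (a2 x) x) (ha2 : HasDerivAt a2 a3 x) (hu0 : HasDerivAt u0 (u1 x) x)
    (hu1 : HasDerivAt u1 (u2 x) x) (hu2 : HasDerivAt u2 u3 x) (hut : HasDerivAt ut utx x) :
    HasDerivAt (fun y => flux (a1 y) (a2 y) (u0 y) (u1 y) (u2 y) (ut y))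
      (fluxDeriv (a1 x) (a2 x) a3 (u0 x) (u1 x) (u2 x) u3 (ut x) utx) x := by
  unfold flux
  refine (((((((((ha1.const_mul 3).mul hu1).mul hut).add
    ((ha1.const_mul (3 / 2)).mul (hu2.pow 2))).add (((ha2.const_mul 3).mul hu1).mul hu2)).add
    (((ha1.pow 3).mul hu0).mul hu2)).add
    (((((ha1.pow 2).const_mul 6).mul ha2).mul hu0).mul hu1)).add
    (((ha1.pow 3).const_mul 4).mul (hu1.pow 2))).add
    (((ha1.pow 5).const_mul (3 / 2)).mul (hu0.pow 2))).congr_deriv ?_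
  unfold fluxDeriv
  simp only [Pi.pow_apply, Pi.mul_apply]
  push_cast
  ring

lemma hasDerivAt_density {a1 u0 u1 : ℝ → ℝ} {a1t ut utx t : ℝ}
    (ha1 : HasDerivAt a1 a1t t) (hu0 : HasDerivAt u0 ut t) (hu1 : HasDerivAt u1 utx t) :
    HasDerivAt (fun r => density (a1 r) (u0 r) (u1 r))
      (densityDeriv (a1 t) a1t (u0 t) (u1 t) ut utx) t := by
  unfold density
  refine (((ha1.const_mul (-3 / 2)).mul (hu1.pow 2)).add
    (((ha1.pow 3).const_mul (1 / 2)).mul (hu0.pow 2))).congr_deriv ?_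
  unfold densityDeriv
  simp only [Pi.pow_apply]
  push_cast
  ring

/-- The difference between the right side and the derivatives in the Carleman identity is a
quadratic form whose leading part is governed by `-a2`. -/
lemma carleman_pointwise (a1 a2 a3 α a1t u0 u1 u2 u3 ut utx : ℝ) :
    fluxDeriv a1 a2 a3 u0 u1 u2 u3 ut utx + densityDeriv a1 a1t u0 u1 ut utx
      + (-9 / 2 * a2 * u2 ^ 2 - 9 * a1 ^ 2 * a2 * u1 ^ 2 - 9 / 2 * a1 ^ 4 * a2 * u0 ^ 2
        - 3 * a3 * u1 * u2 - (3 * a1 * a2 ^ 2 + 6 * a1 ^ 2 * a3) * u0 * u1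
        + 3 / 2 * a1t * u1 ^ 2 - 3 / 2 * a1 ^ 2 * a1t * u0 ^ 2
        - 1 / 2 * (α + a3) ^ 2 * u0 ^ 2) ≤
      1 / 2 * (ut + α * u0 + u3 + 3 * a1 * u2 + 3 * (a2 + a1 ^ 2) * u1
        + (a3 + 3 * a1 * a2 + a1 ^ 3) * u0) ^ 2 := by
  set M1 := ut + u3 + 3 * a1 ^ 2 * u1 + 3 * a1 * a2 * u0 with hM1
  set M2 := 3 * a1 * u2 + 3 * a2 * u1 + a1 ^ 3 * u0 with hM2
  set r := (α + a3) * u0 with hr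
  have hid : fluxDeriv a1 a2 a3 u0 u1 u2 u3 ut utx + densityDeriv a1 a1t u0 u1 ut utx
      + (-9 / 2 * a2 * u2 ^ 2 - 9 * a1 ^ 2 * a2 * u1 ^ 2 - 9 / 2 * a1 ^ 4 * a2 * u0 ^ 2
        - 3 * a3 * u1 * u2 - (3 * a1 * a2 ^ 2 + 6 * a1 ^ 2 * a3) * u0 * u1
        + 3 / 2 * a1t * u1 ^ 2 - 3 / 2 * a1 ^ 2 * a1t * u0 ^ 2
        - 1 / 2 * (α + a3) ^ 2 * u0 ^ 2) = M1 * M2 - 1 / 2 * r ^ 2 := by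
    unfold fluxDeriv densityDeriv
    rw [hM1, hM2, hr]
    ring
  have hrhs : ut + α * u0 + u3 + 3 * a1 * u2 + 3 * (a2 + a1 ^ 2) * u1
      + (a3 + 3 * a1 * a2 + a1 ^ 3) * u0 = M1 + M2 + r := by
    rw [hM1, hM2, hr]
    ring
  rw [hid, hrhs]
  nlinarith [sq_nonneg (M1 - M2), sq_nonneg (M1 + M2 + 2 * r)]

lemma abs_signed_sum_le (p q r v w : ℝ) :
    |p - q + r - v - w| ≤ |p| + |q| + |r| + |v| + |w| := by
  have i1 := abs_sub (p - q + r - v) w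
  have i2 := abs_sub (p - q + r) v
  have i3 := abs_add_le (p - q) r
  have i4 := abs_sub p q
  linarith

/-- Absorption of the lower order terms: `energy` bounds them with a factor `1 / l`. -/
lemma abs_lower_order_le {A l b2 b3 bt b1t b1 u0 u1 u2 : ℝ} (hA : 1 ≤ A) (hl : 1 ≤ l)
    (h1 : |b1| ≤ A) (h2 : |b2| ≤ A) (h3 : |b3| ≤ A) (ht : |bt| ≤ A) (h1t : |b1t| ≤ A) :
    |-3 * (l * b3) * u1 * u2
        - (3 * (l * b1) * (l * b2) ^ 2 + 6 * (l * b1) ^ 2 * (l * b3)) * u0 * u1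
        + 3 / 2 * (l ^ 2 * b1t) * u1 ^ 2 - 3 / 2 * (l * b1) ^ 2 * (l ^ 2 * b1t) * u0 ^ 2
        - 1 / 2 * (l ^ 2 * bt + l * b3) ^ 2 * u0 ^ 2| * l ≤ 12 * A ^ 3 * energy l u0 u1 u2 := by
  have hA0 : 0 ≤ A := by linarith
  have hl0 : 0 ≤ l := by linarith
  have e1 : |(-3) * (l * b3) * u1 * u2| ≤ 3 * (l * A) * |u1| * |u2| := by
    rw [abs_mul, abs_mul, abs_mul, abs_mul, abs_of_nonneg hl0]
    norm_num
    gcongr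
  have e2 : |(3 * (l * b1) * (l * b2) ^ 2 + 6 * (l * b1) ^ 2 * (l * b3)) * u0 * u1|
      ≤ (9 * l ^ 3 * A ^ 3) * |u0| * |u1| := by
    rw [abs_mul, abs_mul]
    gcongr
    calc _ ≤ |3 * (l * b1) * (l * b2) ^ 2| + |6 * (l * b1) ^ 2 * (l * b3)| := abs_add_le _ _
      _ = 3 * (l * |b1|) * (l * |b2|) ^ 2 + 6 * (l * |b1|) ^ 2 * (l * |b3|) := by
        simp only [abs_mul, abs_pow, abs_of_nonneg hl0]
        norm_num
      _ ≤ 3 * (l * A) * (l * A) ^ 2 + 6 * (l * A) ^ 2 * (l * A) := by gcongr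
      _ = _ := by ring
  have e3 : |3 / 2 * (l ^ 2 * b1t) * u1 ^ 2| ≤ 3 / 2 * (l ^ 2 * A) * u1 ^ 2 := by
    simp only [abs_mul, abs_pow, abs_of_nonneg hl0, sq_abs]
    norm_num
    gcongr
  have e4 : |3 / 2 * (l * b1) ^ 2 * (l ^ 2 * b1t) * u0 ^ 2|
      ≤ 3 / 2 * (l * A) ^ 2 * (l ^ 2 * A) * u0 ^ 2 := by
    rw [abs_mul, abs_mul, abs_mul, abs_pow, abs_pow u0, sq_abs u0, abs_mul l, abs_mul (l ^ 2),
      abs_pow, abs_of_nonneg hl0]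
    norm_num only
    gcongr
  have e5 : |1 / 2 * (l ^ 2 * bt + l * b3) ^ 2 * u0 ^ 2| ≤ 2 * A ^ 2 * l ^ 4 * u0 ^ 2 := by
    have h : |l ^ 2 * bt + l * b3| ≤ 2 * l ^ 2 * A := by
      calc _ ≤ |l ^ 2 * bt| + |l * b3| := abs_add_le _ _
        _ = l ^ 2 * |bt| + l * |b3| := by simp only [abs_mul, abs_pow, abs_of_nonneg hl0]
        _ ≤ l ^ 2 * A + l ^ 2 * A := by
          gcongr
          nlinarith
        _ = _ := by ring
    have h' := pow_le_pow_left₀ (abs_nonneg _) h 2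
    rw [sq_abs] at h'
    rw [abs_of_nonneg (by positivity)]
    nlinarith [mul_le_mul_of_nonneg_right h' (sq_nonneg u0)]
  have hsum := (abs_signed_sum_le (-3 * (l * b3) * u1 * u2)
    ((3 * (l * b1) * (l * b2) ^ 2 + 6 * (l * b1) ^ 2 * (l * b3)) * u0 * u1)
    (3 / 2 * (l ^ 2 * b1t) * u1 ^ 2) (3 / 2 * (l * b1) ^ 2 * (l ^ 2 * b1t) * u0 ^ 2)
    (1 / 2 * (l ^ 2 * bt + l * b3) ^ 2 * u0 ^ 2)).trans
    (add_le_add (add_le_add (add_le_add (add_le_add e1 e2) e3) e4) e5)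
  refine (mul_le_mul_of_nonneg_right hsum hl0).trans ?_
  have hA3 : A ≤ A ^ 3 := le_self_pow₀ hA (by norm_num)
  have hA2 : A ^ 2 ≤ A ^ 3 := pow_le_pow_right₀ hA (by norm_num)
  have y1 : 2 * l ^ 2 * |u1| * |u2| ≤ l * u2 ^ 2 + l ^ 3 * u1 ^ 2 := by
    rw [← sq_abs u1, ← sq_abs u2]
    nlinarith [mul_nonneg hl0 (sq_nonneg (|u2| - l * |u1|))]
  have y2 : 2 * l ^ 4 * |u0| * |u1| ≤ l ^ 3 * u1 ^ 2 + l ^ 5 * u0 ^ 2 := by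
    rw [← sq_abs u1, ← sq_abs u0]
    nlinarith [mul_nonneg (pow_nonneg hl0 3) (sq_nonneg (|u1| - l * |u0|))]
  have p2 : 0 ≤ l * u2 ^ 2 := by positivity
  have p1 : 0 ≤ l ^ 3 * u1 ^ 2 := by positivity
  have p0 : 0 ≤ l ^ 5 * u0 ^ 2 := by positivity
  unfold energy
  calc _ = 3 / 2 * A * (2 * l ^ 2 * |u1| * |u2|) + 9 / 2 * A ^ 3 * (2 * l ^ 4 * |u0| * |u1|)
        + 3 / 2 * A * (l ^ 3 * u1 ^ 2) + 3 / 2 * A ^ 3 * (l ^ 5 * u0 ^ 2)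
        + 2 * A ^ 2 * (l ^ 5 * u0 ^ 2) := by ring
    _ ≤ 3 / 2 * A ^ 3 * (l * u2 ^ 2 + l ^ 3 * u1 ^ 2)
        + 9 / 2 * A ^ 3 * (l ^ 3 * u1 ^ 2 + l ^ 5 * u0 ^ 2)
        + 3 / 2 * A ^ 3 * (l ^ 3 * u1 ^ 2) + 3 / 2 * A ^ 3 * (l ^ 5 * u0 ^ 2)
        + 2 * A ^ 3 * (l ^ 5 * u0 ^ 2) := by gcongr
    _ ≤ _ := by
      have n0 : 0 ≤ A ^ 3 * (l ^ 5 * u0 ^ 2) := by positivity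
      have n1 : 0 ≤ A ^ 3 * (l ^ 3 * u1 ^ 2) := by positivity
      have n2 : 0 ≤ A ^ 3 * (l * u2 ^ 2) := by positivity
      linear_combination 21 / 2 * n2 + 9 / 2 * n1 + 4 * n0

lemma energy_nonneg {l : ℝ} (hl : 0 ≤ l) (u0 u1 u2 : ℝ) : 0 ≤ energy l u0 u1 u2 := by
  unfold energy
  positivity

/-- Where the weight is uniformly monotone and concave, the Carleman quadratic form is coercive. -/
lemma carleman_coercive {A δ l b1 b2 b3 bt b1t u0 u1 u2 u3 ut utx : ℝ} (hA : 1 ≤ A)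
    (hδ : 0 < δ) (hδ1 : δ ≤ 1) (hl : 12 * A ^ 3 / δ ^ 5 ≤ l)
    (h1 : |b1| ≤ A) (h2 : |b2| ≤ A) (h3 : |b3| ≤ A) (ht : |bt| ≤ A) (h1t : |b1t| ≤ A)
    (hb1 : δ ≤ |b1|) (hb2 : b2 ≤ -δ) :
    fluxDeriv (l * b1) (l * b2) (l * b3) u0 u1 u2 u3 ut utx
        + densityDeriv (l * b1) (l ^ 2 * b1t) u0 u1 ut utx + 3 * δ ^ 5 * energy l u0 u1 u2 ≤
      1 / 2 * (ut + l ^ 2 * bt * u0 + u3 + 3 * (l * b1) * u2 + 3 * (l * b2 + (l * b1) ^ 2) * u1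
        + (l * b3 + 3 * (l * b1) * (l * b2) + (l * b1) ^ 3) * u0) ^ 2 := by
  have hδ5 : 0 < δ ^ 5 := by positivity
  have hδ51 : δ ^ 5 ≤ 1 := pow_le_one₀ hδ.le hδ1
  have hA3 : 1 ≤ A ^ 3 := one_le_pow₀ hA
  have hl' : 12 * A ^ 3 ≤ l * δ ^ 5 := (div_le_iff₀ hδ5).1 hl
  have hl1 : 1 ≤ l := by
    refine le_trans ?_ hl
    rw [le_div_iff₀ hδ5]
    linarith
  have hl0 : 0 < l := by linarith
  refine le_trans ?_ (carleman_pointwise (l * b1) (l * b2) (l * b3) (l ^ 2 * bt)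
    (l ^ 2 * b1t) u0 u1 u2 u3 ut utx)
  have hE := energy_nonneg hl0.le u0 u1 u2
  have hlow := abs_lower_order_le (u0 := u0) (u1 := u1) (u2 := u2) hA hl1 h1 h2 h3 ht h1t
  set R := -3 * (l * b3) * u1 * u2
        - (3 * (l * b1) * (l * b2) ^ 2 + 6 * (l * b1) ^ 2 * (l * b3)) * u0 * u1
        + 3 / 2 * (l ^ 2 * b1t) * u1 ^ 2 - 3 / 2 * (l * b1) ^ 2 * (l ^ 2 * b1t) * u0 ^ 2
        - 1 / 2 * (l ^ 2 * bt + l * b3) ^ 2 * u0 ^ 2 with hR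
  have hRle : -(δ ^ 5 * energy l u0 u1 u2) ≤ R := by
    have : |R| ≤ δ ^ 5 * energy l u0 u1 u2 := by
      refine le_of_mul_le_mul_right ?_ hl0
      calc |R| * l ≤ 12 * A ^ 3 * energy l u0 u1 u2 := hlow
        _ ≤ l * δ ^ 5 * energy l u0 u1 u2 := by gcongr
        _ = _ := by ring
    exact (abs_le.1 this).1
  have hb12 : δ ^ 2 ≤ b1 ^ 2 := by
    rw [← sq_abs b1]
    gcongr
  have hb14 : δ ^ 4 ≤ b1 ^ 4 := by nlinarith [sq_nonneg δ]
  have c2 : δ ^ 5 ≤ -b2 := by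
    have : δ ^ 5 ≤ δ := pow_le_of_le_one hδ.le hδ1 (by norm_num)
    linarith
  have c1 : δ ^ 5 ≤ b1 ^ 2 * -b2 := by
    calc δ ^ 5 ≤ δ ^ 3 := pow_le_pow_of_le_one hδ.le hδ1 (by norm_num)
      _ = δ ^ 2 * δ := by ring
      _ ≤ _ := mul_le_mul hb12 (by linarith) hδ.le (by positivity)
  have c0 : δ ^ 5 ≤ b1 ^ 4 * -b2 := by
    calc δ ^ 5 = δ ^ 4 * δ := by ring
      _ ≤ _ := mul_le_mul hb14 (by linarith) hδ.le (by positivity)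
  have d2 := mul_le_mul_of_nonneg_right c2 (show 0 ≤ l * u2 ^ 2 by positivity)
  have d1 := mul_le_mul_of_nonneg_right c1 (show 0 ≤ l ^ 3 * u1 ^ 2 by positivity)
  have d0 := mul_le_mul_of_nonneg_right c0 (show 0 ≤ l ^ 5 * u0 ^ 2 by positivity)
  have hmain : 4 * δ ^ 5 * energy l u0 u1 u2 ≤ -9 / 2 * (l * b2) * u2 ^ 2
      - 9 * (l * b1) ^ 2 * (l * b2) * u1 ^ 2 - 9 / 2 * (l * b1) ^ 4 * (l * b2) * u0 ^ 2 := by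
    have n2 : 0 ≤ δ ^ 5 * (l * u2 ^ 2) := by positivity
    have n1 : 0 ≤ δ ^ 5 * (l ^ 3 * u1 ^ 2) := by positivity
    have n0 : 0 ≤ δ ^ 5 * (l ^ 5 * u0 ^ 2) := by positivity
    unfold energy
    linear_combination 9 / 2 * d2 + 9 * d1 + 9 / 2 * d0 + 1 / 2 * n2 + 5 * n1 + 1 / 2 * n0
  linear_combination hmain + hRle

/-- Without assumptions on the weight, the Carleman quadratic form is bounded below by the
energy. -/
lemma carleman_lower_bound {A l b1 b2 b3 bt b1t u0 u1 u2 u3 ut utx : ℝ} (hA : 1 ≤ A)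
    (hl : 1 ≤ l)
    (h1 : |b1| ≤ A) (h2 : |b2| ≤ A) (h3 : |b3| ≤ A) (ht : |bt| ≤ A) (h1t : |b1t| ≤ A) :
    fluxDeriv (l * b1) (l * b2) (l * b3) u0 u1 u2 u3 ut utx
        + densityDeriv (l * b1) (l ^ 2 * b1t) u0 u1 ut utx ≤
      1 / 2 * (ut + l ^ 2 * bt * u0 + u3 + 3 * (l * b1) * u2 + 3 * (l * b2 + (l * b1) ^ 2) * u1
        + (l * b3 + 3 * (l * b1) * (l * b2) + (l * b1) ^ 3) * u0) ^ 2
        + 21 * A ^ 5 * energy l u0 u1 u2 := by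
  have hA0 : 0 ≤ A := by linarith
  have hl0 : 0 < l := by linarith
  refine le_trans ?_ (add_le_add_left (carleman_pointwise (l * b1) (l * b2) (l * b3) (l ^ 2 * bt)
    (l ^ 2 * b1t) u0 u1 u2 u3 ut utx) _)
  have hE := energy_nonneg hl0.le u0 u1 u2
  have hlow := abs_lower_order_le (u0 := u0) (u1 := u1) (u2 := u2) hA hl h1 h2 h3 ht h1t
  set R := -3 * (l * b3) * u1 * u2
        - (3 * (l * b1) * (l * b2) ^ 2 + 6 * (l * b1) ^ 2 * (l * b3)) * u0 * u1
        + 3 / 2 * (l ^ 2 * b1t) * u1 ^ 2 - 3 / 2 * (l * b1) ^ 2 * (l ^ 2 * b1t) * u0 ^ 2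
        - 1 / 2 * (l ^ 2 * bt + l * b3) ^ 2 * u0 ^ 2 with hR
  have hA35 : A ^ 3 ≤ A ^ 5 := pow_le_pow_right₀ hA (by norm_num)
  have hRle : -(12 * A ^ 5 * energy l u0 u1 u2) ≤ R := by
    have : |R| ≤ 12 * A ^ 5 * energy l u0 u1 u2 := by
      calc |R| ≤ |R| * l := le_mul_of_one_le_right (abs_nonneg _) hl
        _ ≤ 12 * A ^ 3 * energy l u0 u1 u2 := hlow
        _ ≤ _ := by gcongr
    exact (abs_le.1 this).1
  have hb2 : b2 ≤ A := (le_abs_self _).trans h2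
  have hb12 : b1 ^ 2 ≤ A ^ 2 := by
    rw [← sq_abs b1]
    gcongr
  have hb14 : b1 ^ 4 ≤ A ^ 4 := by nlinarith [sq_nonneg b1]
  have c2 : b2 ≤ A ^ 5 := hb2.trans (le_self_pow₀ hA (by norm_num))
  have c1 : b1 ^ 2 * b2 ≤ A ^ 5 :=
    calc b1 ^ 2 * b2 ≤ b1 ^ 2 * A := by gcongr
      _ ≤ A ^ 2 * A := by gcongr
      _ = A ^ 3 := by ring
      _ ≤ A ^ 5 := hA35
  have c0 : b1 ^ 4 * b2 ≤ A ^ 5 :=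
    calc b1 ^ 4 * b2 ≤ b1 ^ 4 * A := by gcongr
      _ ≤ A ^ 4 * A := by gcongr
      _ = A ^ 5 := by ring
  have d2 := mul_le_mul_of_nonneg_right c2 (show 0 ≤ l * u2 ^ 2 by positivity)
  have d1 := mul_le_mul_of_nonneg_right c1 (show 0 ≤ l ^ 3 * u1 ^ 2 by positivity)
  have d0 := mul_le_mul_of_nonneg_right c0 (show 0 ≤ l ^ 5 * u0 ^ 2 by positivity)
  have hmain : -(9 * A ^ 5 * energy l u0 u1 u2) ≤ -9 / 2 * (l * b2) * u2 ^ 2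
      - 9 * (l * b1) ^ 2 * (l * b2) * u1 ^ 2 - 9 / 2 * (l * b1) ^ 4 * (l * b2) * u0 ^ 2 := by
    have n2 : 0 ≤ A ^ 5 * (l * u2 ^ 2) := by positivity
    have n0 : 0 ≤ A ^ 5 * (l ^ 5 * u0 ^ 2) := by positivity
    unfold energy
    linear_combination 9 / 2 * d2 + 9 * d1 + 9 / 2 * d0 + 9 / 2 * n2 + 9 / 2 * n0
  linear_combination hmain + hRle

/-- Lower triangular changes of the jet with coefficients of the natural order in `l` preserve
the energy up to a constant. -/
lemma energy_triangular_le {B l b1 b2 b3 : ℝ} (hl : 0 ≤ l) (h1 : |b1| ≤ B) (h2 : |b2| ≤ B)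
    (h3 : |b3| ≤ B) (p0 p1 p2 : ℝ) :
    energy l p0 (p1 + l * b1 * p0) (p2 + l * b2 * p1 + l ^ 2 * b3 * p0)
      ≤ (3 + 5 * B ^ 2) * energy l p0 p1 p2 := by
  have hsq : ∀ b : ℝ, |b| ≤ B → b ^ 2 ≤ B ^ 2 := fun b hb => by
    rw [← sq_abs b]
    gcongr
  have k1 : (p1 + l * b1 * p0) ^ 2 ≤ 2 * p1 ^ 2 + 2 * B ^ 2 * (l ^ 2 * p0 ^ 2) := by
    have := mul_le_mul_of_nonneg_right (hsq b1 h1) (show 0 ≤ l ^ 2 * p0 ^ 2 by positivity)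
    nlinarith [sq_nonneg (p1 - l * b1 * p0)]
  have k2 : (p2 + l * b2 * p1 + l ^ 2 * b3 * p0) ^ 2
      ≤ 3 * p2 ^ 2 + 3 * B ^ 2 * (l ^ 2 * p1 ^ 2) + 3 * B ^ 2 * (l ^ 4 * p0 ^ 2) := by
    have e1 := mul_le_mul_of_nonneg_right (hsq b2 h2) (show 0 ≤ l ^ 2 * p1 ^ 2 by positivity)
    have e2 := mul_le_mul_of_nonneg_right (hsq b3 h3) (show 0 ≤ l ^ 4 * p0 ^ 2 by positivity)
    nlinarith [sq_nonneg (p2 - l * b2 * p1), sq_nonneg (p2 - l ^ 2 * b3 * p0),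
      sq_nonneg (l * b2 * p1 - l ^ 2 * b3 * p0)]
  have m1 := mul_le_mul_of_nonneg_left k1 (pow_nonneg hl 3)
  have m2 := mul_le_mul_of_nonneg_left k2 hl
  have n2 : 0 ≤ B ^ 2 * (l * p2 ^ 2) := by positivity
  have n1 : 0 ≤ B ^ 2 * (l ^ 3 * p1 ^ 2) := by positivity
  have n1' : 0 ≤ l ^ 3 * p1 ^ 2 := by positivity
  have n0' : 0 ≤ l ^ 5 * p0 ^ 2 := by positivity
  unfold energy
  linear_combination m1 + m2 + 5 * n2 + 2 * n1 + n1' + 2 * n0'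

end Pointwise

section FixedTime

lemma energy_scale_le {A l m : ℝ} (hA : 1 ≤ A) (hl : 0 ≤ l) (hm : 0 ≤ m) (hmA : m ≤ A)
    (p0 p1 p2 : ℝ) : energy (l * m) p0 p1 p2 ≤ A ^ 5 * energy l p0 p1 p2 := by
  have h1 : m ≤ A ^ 5 := hmA.trans (le_self_pow₀ hA (by norm_num))
  have h3 : m ^ 3 ≤ A ^ 5 := (pow_le_pow_left₀ hm hmA 3).trans (pow_le_pow_right₀ hA (by norm_num))
  have h5 : m ^ 5 ≤ A ^ 5 := pow_le_pow_left₀ hm hmA 5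
  have d1 := mul_le_mul_of_nonneg_right h1 (show 0 ≤ l * p2 ^ 2 by positivity)
  have d3 := mul_le_mul_of_nonneg_right h3 (show 0 ≤ l ^ 3 * p1 ^ 2 by positivity)
  have d5 := mul_le_mul_of_nonneg_right h5 (show 0 ≤ l ^ 5 * p0 ^ 2 by positivity)
  unfold energy
  linear_combination d1 + d3 + d5

lemma energy_le_scale {δ l m : ℝ} (hδ : 0 < δ) (hδ1 : δ ≤ 1) (hl : 0 ≤ l) (hm : δ ≤ m)
    (p0 p1 p2 : ℝ) : energy l p0 p1 p2 ≤ (δ ^ 5)⁻¹ * energy (l * m) p0 p1 p2 := by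
  rw [le_inv_mul_iff₀ (by positivity)]
  have h1 : δ ^ 5 ≤ m := (pow_le_of_le_one hδ.le hδ1 (by norm_num)).trans hm
  have h3 : δ ^ 5 ≤ m ^ 3 :=
    (pow_le_pow_of_le_one hδ.le hδ1 (by norm_num)).trans (pow_le_pow_left₀ hδ.le hm 3)
  have h5 : δ ^ 5 ≤ m ^ 5 := pow_le_pow_left₀ hδ.le hm 5
  have d1 := mul_le_mul_of_nonneg_right h1 (show 0 ≤ l * p2 ^ 2 by positivity)
  have d3 := mul_le_mul_of_nonneg_right h3 (show 0 ≤ l ^ 3 * p1 ^ 2 by positivity)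
  have d5 := mul_le_mul_of_nonneg_right h5 (show 0 ≤ l ^ 5 * p0 ^ 2 by positivity)
  unfold energy
  linear_combination d1 + d3 + d5

/-- The constant comparing the energies of a function and of its conjugate by the weight. -/
noncomputable def compConst (A δ : ℝ) : ℝ := (3 + 20 * A ^ 4) * (A ^ 5 + (δ ^ 5)⁻¹)

lemma compConst_pos {A δ : ℝ} (hA : 1 ≤ A) (hδ : 0 < δ) : 0 < compConst A δ := by
  unfold compConst
  positivity

lemma conj_coeff_bounds {A l b1 b2 : ℝ} (hA : 1 ≤ A) (hl : 1 ≤ l) (h1 : |b1| ≤ A)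
    (h2 : |b2| ≤ A) :
    |b1| ≤ 2 * A ^ 2 ∧ |2 * b1| ≤ 2 * A ^ 2 ∧ |b1 ^ 2 + b2 / l| ≤ 2 * A ^ 2
      ∧ |b1 ^ 2 - b2 / l| ≤ 2 * A ^ 2 := by
  have hA2 : A ≤ A ^ 2 := le_self_pow₀ hA (by norm_num)
  have hdiv : |b2 / l| ≤ A := by
    rw [abs_div, abs_of_pos (by linarith : 0 < l)]
    exact (div_le_self (abs_nonneg _) hl).trans h2
  have hsq : |b1 ^ 2| ≤ A ^ 2 := by
    rw [abs_pow]
    gcongr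
  refine ⟨by linarith, ?_, ?_, ?_⟩
  · rw [abs_mul]
    norm_num
    linarith
  · linarith [abs_add_le (b1 ^ 2) (b2 / l)]
  · linarith [abs_sub (b1 ^ 2) (b2 / l)]

section Conjugate

variable {A δ l m b1 b2 : ℝ} (hA : 1 ≤ A) (hδ : 0 < δ) (hl : 1 ≤ l)
  (hm : δ ≤ m) (h1 : |b1| ≤ A) (h2 : |b2| ≤ A)

include hA hδ hl hm h1 h2

lemma energy_le_conj (hmA : m ≤ A) (e q0 q1 q2 : ℝ) :
    energy (l * m) (e * q0) (e * q1) (e * q2) ≤ compConst A δ *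
      energy l (e * q0) (e * (q1 - l * b1 * q0))
        (e * (q2 - 2 * (l * b1) * q1 + ((l * b1) ^ 2 - l * b2) * q0)) := by
  have hl0 : 0 < l := by linarith
  obtain ⟨c1, c2, c3, -⟩ := conj_coeff_bounds hA hl h1 h2
  refine (energy_scale_le hA hl0.le (by linarith) hmA _ _ _).trans ?_
  have key := energy_triangular_le hl0.le c1 c2 c3 (e * q0) (e * (q1 - l * b1 * q0))
    (e * (q2 - 2 * (l * b1) * q1 + ((l * b1) ^ 2 - l * b2) * q0))
  have r1 : e * (q1 - l * b1 * q0) + l * b1 * (e * q0) = e * q1 := by ring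
  have r2 : e * (q2 - 2 * (l * b1) * q1 + ((l * b1) ^ 2 - l * b2) * q0)
      + l * (2 * b1) * (e * (q1 - l * b1 * q0)) + l ^ 2 * (b1 ^ 2 + b2 / l) * (e * q0)
      = e * q2 := by
    field_simp
    ring
  rw [r1, r2] at key
  have hE := energy_nonneg hl0.le (e * q0) (e * (q1 - l * b1 * q0))
    (e * (q2 - 2 * (l * b1) * q1 + ((l * b1) ^ 2 - l * b2) * q0))
  refine (mul_le_mul_of_nonneg_left key (by positivity)).trans ?_
  rw [← mul_assoc]
  refine mul_le_mul_of_nonneg_right ?_ hE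
  unfold compConst
  have : 0 ≤ (3 + 20 * A ^ 4) * (δ ^ 5)⁻¹ := by positivity
  linear_combination this

lemma conj_le_energy (hδ1 : δ ≤ 1) (e q0 q1 q2 : ℝ) :
    energy l (e * q0) (e * (q1 - l * b1 * q0))
        (e * (q2 - 2 * (l * b1) * q1 + ((l * b1) ^ 2 - l * b2) * q0)) ≤
      compConst A δ * energy (l * m) (e * q0) (e * q1) (e * q2) := by
  have hl0 : 0 < l := by linarith
  obtain ⟨c1, c2, -, c3⟩ := conj_coeff_bounds hA hl h1 h2
  rw [← abs_neg] at c1 c2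
  have key := energy_triangular_le hl0.le c1 c2 c3 (e * q0) (e * q1) (e * q2)
  have r1 : e * q1 + l * -b1 * (e * q0) = e * (q1 - l * b1 * q0) := by ring
  have r2 : e * q2 + l * -(2 * b1) * (e * q1) + l ^ 2 * (b1 ^ 2 - b2 / l) * (e * q0)
      = e * (q2 - 2 * (l * b1) * q1 + ((l * b1) ^ 2 - l * b2) * q0) := by
    field_simp
    ring
  rw [r1, r2] at key
  refine key.trans ?_
  refine (mul_le_mul_of_nonneg_left (energy_le_scale hδ hδ1 hl0.le hm _ _ _)
    (by positivity)).trans ?_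
  rw [← mul_assoc]
  refine mul_le_mul_of_nonneg_right ?_ (energy_nonneg (by nlinarith) _ _ _)
  unfold compConst
  have : 0 ≤ (3 + 20 * A ^ 4) * A ^ 5 := by positivity
  linear_combination this

end Conjugate

lemma flux_left_le {A δ l b1 b2 u1 u2 : ℝ} (hA : 1 ≤ A) (hδ : 0 < δ) (hδ1 : δ ≤ 1)
    (hl : 12 * A ^ 3 / δ ^ 5 ≤ l) (h2 : |b2| ≤ A) (hb1 : b1 ≤ -δ) :
    flux (l * b1) (l * b2) 0 u1 u2 0 ≤ -(δ ^ 5 * energy l 0 u1 u2) := by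
  have hδ5 : 0 < δ ^ 5 := by positivity
  have hδ51 : δ ^ 5 ≤ 1 := pow_le_one₀ hδ.le hδ1
  have hA3 : A ≤ A ^ 3 := le_self_pow₀ hA (by norm_num)
  have hl' : 12 * A ^ 3 ≤ l * δ ^ 5 := (div_le_iff₀ hδ5).1 hl
  have hl0 : 0 < l := lt_of_lt_of_le (by positivity) hl
  have p2 : 0 ≤ l * u2 ^ 2 := by positivity
  have p1 : 0 ≤ l ^ 3 * u1 ^ 2 := by positivity
  have y1 : 2 * l ^ 2 * |u1| * |u2| ≤ l * u2 ^ 2 + l ^ 3 * u1 ^ 2 := by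
    rw [← sq_abs u1, ← sq_abs u2]
    nlinarith [mul_nonneg hl0.le (sq_nonneg (|u2| - l * |u1|))]
  have hcross : l * b2 * u1 * u2 ≤ δ ^ 5 / 24 * (l * u2 ^ 2 + l ^ 3 * u1 ^ 2) := by
    have : |l * b2 * u1 * u2| * (24 * l) ≤ δ ^ 5 * (l * u2 ^ 2 + l ^ 3 * u1 ^ 2) * l := by
      calc |l * b2 * u1 * u2| * (24 * l) = 12 * |b2| * (2 * l ^ 2 * |u1| * |u2|) := by
            rw [abs_mul, abs_mul, abs_mul, abs_of_pos hl0]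
            ring
        _ ≤ 12 * A ^ 3 * (l * u2 ^ 2 + l ^ 3 * u1 ^ 2) := by
            gcongr
            exact h2.trans hA3
        _ ≤ l * δ ^ 5 * (l * u2 ^ 2 + l ^ 3 * u1 ^ 2) := by gcongr
        _ = _ := by ring
    have h24 : |l * b2 * u1 * u2| * 24 ≤ δ ^ 5 * (l * u2 ^ 2 + l ^ 3 * u1 ^ 2) :=
      le_of_mul_le_mul_right (by linarith) hl0
    linarith [le_abs_self (l * b2 * u1 * u2)]
  have c1 : δ ^ 5 ≤ -b1 := (pow_le_of_le_one hδ.le hδ1 (by norm_num)).trans (by linarith)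
  have c3 : δ ^ 5 ≤ (-b1) ^ 3 :=
    (pow_le_pow_of_le_one hδ.le hδ1 (by norm_num)).trans
      (pow_le_pow_left₀ hδ.le (by linarith) 3)
  have d1 := mul_le_mul_of_nonneg_right c1 p2
  have d3 := mul_le_mul_of_nonneg_right c3 p1
  have n2 : 0 ≤ δ ^ 5 * (l * u2 ^ 2) := by positivity
  have n1 : 0 ≤ δ ^ 5 * (l ^ 3 * u1 ^ 2) := by positivity
  unfold flux energy
  linear_combination 3 / 2 * d1 + 4 * d3 + 3 * hcross + 3 / 8 * n2 + 23 / 8 * n1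

lemma le_flux_right {δ l b1 b2 u2 ut : ℝ} (hδ : 0 < δ) (hδ1 : δ ≤ 1) (hl : 0 ≤ l)
    (hb1 : δ ≤ b1) : δ ^ 5 * energy l 0 0 u2 ≤ flux (l * b1) (l * b2) 0 0 u2 ut := by
  have c1 : δ ^ 5 ≤ b1 := (pow_le_of_le_one hδ.le hδ1 (by norm_num)).trans hb1
  have d1 := mul_le_mul_of_nonneg_right c1 (show 0 ≤ l * u2 ^ 2 by positivity)
  have n : 0 ≤ b1 * (l * u2 ^ 2) := mul_nonneg (by linarith) (by positivity)
  unfold flux energy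
  linear_combination d1 + 1 / 2 * n

/-- Integration of a pointwise inequality carrying an extra term on the subinterval `[l1, l2]`. -/
lemma integral_add_le_of_subinterval {G F E : ℝ → ℝ} {l1 l2 L c C : ℝ} (hl1 : 0 ≤ l1)
    (hl12 : l1 ≤ l2) (hl2 : l2 ≤ L) (hG : Continuous G) (hF : Continuous F) (hE : Continuous E)
    (hout : ∀ x ∈ Icc 0 L, x ∉ Ioo l1 l2 → G x + c * E x ≤ F x)
    (hin : ∀ x ∈ Icc l1 l2, G x + c * E x ≤ F x + C * E x) :
    (∫ x in (0:ℝ)..L, G x) + c * (∫ x in (0:ℝ)..L, E x) ≤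
      (∫ x in (0:ℝ)..L, F x) + C * ∫ x in l1..l2, E x := by
  have hi : ∀ {f : ℝ → ℝ}, Continuous f → ∀ a b, IntervalIntegrable f volume a b :=
    fun h a b => h.intervalIntegrable a b
  have hH : Continuous fun x => G x + c * E x := by fun_prop
  have hK : Continuous fun x => F x + C * E x := by fun_prop
  have split : ∀ {f : ℝ → ℝ}, Continuous f → ∫ x in (0:ℝ)..L, f x
      = (∫ x in (0:ℝ)..l1, f x) + (∫ x in l1..l2, f x) + ∫ x in l2..L, f x := fun h => by
    rw [intervalIntegral.integral_add_adjacent_intervals (hi h _ _) (hi h _ _),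
      intervalIntegral.integral_add_adjacent_intervals (hi h _ _) (hi h _ _)]
  have i1 : ∫ x in (0:ℝ)..l1, (G x + c * E x) ≤ ∫ x in (0:ℝ)..l1, F x :=
    intervalIntegral.integral_mono_on hl1 (hi hH _ _) (hi hF _ _) fun x hx =>
      hout x ⟨hx.1, by linarith [hx.2]⟩ fun h => by linarith [hx.2, h.1]
  have i3 : ∫ x in l2..L, (G x + c * E x) ≤ ∫ x in l2..L, F x :=
    intervalIntegral.integral_mono_on hl2 (hi hH _ _) (hi hF _ _) fun x hx =>
      hout x ⟨by linarith [hx.1], hx.2⟩ fun h => by linarith [hx.1, h.2]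
  have i2 : ∫ x in l1..l2, (G x + c * E x) ≤ ∫ x in l1..l2, (F x + C * E x) :=
    intervalIntegral.integral_mono_on hl12 (hi hH _ _) (hi hK _ _) hin
  have e1 : ∫ x in (0:ℝ)..L, (G x + c * E x)
      = (∫ x in (0:ℝ)..L, G x) + c * ∫ x in (0:ℝ)..L, E x := by
    rw [intervalIntegral.integral_add (hi hG _ _) (hi (by fun_prop) _ _),
      intervalIntegral.integral_const_mul]
  have e2 : ∫ x in l1..l2, (F x + C * E x)
      = (∫ x in l1..l2, F x) + C * ∫ x in l1..l2, E x := by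
    rw [intervalIntegral.integral_add (hi hF _ _) (hi (by fun_prop) _ _),
      intervalIntegral.integral_const_mul]
  rw [← e1, split hH, split hF]
  linarith

/-- Quantitative form of the hypotheses on the weight and its first three derivatives. -/
structure WeightBounds (A δ L l1 l2 : ℝ) (ψ ψ1 ψ2 ψ3 : ℝ → ℝ) : Prop where
  one_le : 1 ≤ A
  pos : 0 < δ
  le_one : δ ≤ 1
  hasDeriv0 : ∀ x, HasDerivAt ψ (ψ1 x) x
  hasDeriv1 : ∀ x, HasDerivAt ψ1 (ψ2 x) x
  hasDeriv2 : ∀ x, HasDerivAt ψ2 (ψ3 x) x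
  cont3 : Continuous ψ3
  lower : ∀ x ∈ Icc 0 L, δ ≤ ψ x
  bound0 : ∀ x ∈ Icc 0 L, |ψ x| ≤ A
  bound1 : ∀ x ∈ Icc 0 L, |ψ1 x| ≤ A
  bound2 : ∀ x ∈ Icc 0 L, |ψ2 x| ≤ A
  bound3 : ∀ x ∈ Icc 0 L, |ψ3 x| ≤ A
  slope : ∀ x ∈ Icc 0 L, x ∉ Ioo l1 l2 → δ ≤ |ψ1 x|
  concave : ∀ x ∈ Icc 0 L, x ∉ Ioo l1 l2 → ψ2 x ≤ -δ
  left : ψ1 0 ≤ -δ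
  right : δ ≤ ψ1 L

/-- The coercivity constant in the Carleman estimate. -/
noncomputable def coerConst (A δ : ℝ) : ℝ := δ ^ 5 / compConst A δ

/-- The observation constant in the Carleman estimate. -/
noncomputable def obsConst (A δ : ℝ) : ℝ := 21 * A ^ 5 * compConst A δ + coerConst A δ

lemma coerConst_pos {A δ : ℝ} (hA : 1 ≤ A) (hδ : 0 < δ) : 0 < coerConst A δ :=
  div_pos (by positivity) (compConst_pos hA hδ)

lemma obsConst_pos {A δ : ℝ} (hA : 1 ≤ A) (hδ : 0 < δ) : 0 < obsConst A δ := by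
  have := coerConst_pos hA hδ
  have := compConst_pos hA hδ
  unfold obsConst
  positivity

/-- The integrated Carleman inequality at a fixed time; `l` is the size of the weight and
`l ^ 2 * κ` that of its time derivative. -/
lemma fixed_time_estimate {A δ L l1 l2 : ℝ} {ψ ψ1 ψ2 ψ3 : ℝ → ℝ}
    (hψ : WeightBounds A δ L l1 l2 ψ ψ1 ψ2 ψ3) (hl1 : 0 ≤ l1) (hl12 : l1 ≤ l2) (hl2 : l2 ≤ L)
    {l κ : ℝ} (hl : 12 * A ^ 3 / δ ^ 5 ≤ l) (hκ : |κ| ≤ 1)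
    {q0 q1 q2 q3 qt qtx : ℝ → ℝ}
    (hq0 : ∀ x, HasDerivAt q0 (q1 x) x) (hq1 : ∀ x, HasDerivAt q1 (q2 x) x)
    (hq2 : ∀ x, HasDerivAt q2 (q3 x) x) (hqt : ∀ x, HasDerivAt qt (qtx x) x)
    (hq3c : Continuous q3) (hqtxc : Continuous qtx)
    (h00 : q0 0 = 0) (ht0 : qt 0 = 0) (h0L : q0 L = 0) (h1L : q1 L = 0)
    {e : ℝ → ℝ} (he : e = fun x => Real.exp (-(l * ψ x))) :
    coerConst A δ * ((∫ x in (0:ℝ)..L, energy (l * ψ x) (e x * q0 x) (e x * q1 x) (e x * q2 x))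
        + energy (l * ψ 0) 0 (e 0 * q1 0) (e 0 * q2 0) + energy (l * ψ L) 0 0 (e L * q2 L))
      + (∫ x in (0:ℝ)..L, densityDeriv (l * ψ1 x) (l ^ 2 * (κ * ψ1 x)) (e x * q0 x)
          (e x * (q1 x - l * ψ1 x * q0 x)) (e x * (qt x - l ^ 2 * (κ * ψ x) * q0 x))
          (-(l * ψ1 x) * e x * (qt x - l ^ 2 * (κ * ψ x) * q0 x)
            + e x * (qtx x - l ^ 2 * κ * (ψ1 x * q0 x + ψ x * q1 x)))) ≤
      1 / 2 * (∫ x in (0:ℝ)..L, (e x * (qt x + q3 x)) ^ 2)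
        + obsConst A δ * ∫ x in l1..l2,
            energy (l * ψ x) (e x * q0 x) (e x * q1 x) (e x * q2 x) := by
  have hA := hψ.one_le
  have hδ := hψ.pos
  have hδ1 := hψ.le_one
  have hL : 0 ≤ L := by linarith
  have hl1' : 1 ≤ l := by
    refine le_trans ?_ hl
    rw [le_div_iff₀ (by positivity)]
    have : δ ^ 5 ≤ 1 := pow_le_one₀ hδ.le hδ1
    have : 1 ≤ A ^ 3 := one_le_pow₀ hA
    linarith
  have hl0 : 0 < l := by linarith
  have hK := compConst_pos hA hδ
  have c0 : Continuous q0 := continuous_iff_continuousAt.2 fun x => (hq0 x).continuousAt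
  have c1 : Continuous q1 := continuous_iff_continuousAt.2 fun x => (hq1 x).continuousAt
  have c2 : Continuous q2 := continuous_iff_continuousAt.2 fun x => (hq2 x).continuousAt
  have ct : Continuous qt := continuous_iff_continuousAt.2 fun x => (hqt x).continuousAt
  have d0 : Continuous ψ := continuous_iff_continuousAt.2 fun x => (hψ.hasDeriv0 x).continuousAt
  have d1 : Continuous ψ1 := continuous_iff_continuousAt.2 fun x => (hψ.hasDeriv1 x).continuousAt
  have d2 : Continuous ψ2 := continuous_iff_continuousAt.2 fun x => (hψ.hasDeriv2 x).continuousAt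
  have d3 := hψ.cont3
  have hed : ∀ x, HasDerivAt e (-(l * ψ1 x) * e x) x := fun x => by
    rw [he]
    refine ((((hψ.hasDeriv0 x).const_mul l).neg).exp).congr_deriv ?_
    simp only [Pi.neg_apply]
    ring
  have ce : Continuous e := continuous_iff_continuousAt.2 fun x => (hed x).continuousAt
  set a1 : ℝ → ℝ := fun x => l * ψ1 x with ha1
  set a2 : ℝ → ℝ := fun x => l * ψ2 x with ha2
  set u0 : ℝ → ℝ := fun x => e x * q0 x with hu0
  set u1 : ℝ → ℝ := fun x => e x * (q1 x - l * ψ1 x * q0 x) with hu1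
  set u2 : ℝ → ℝ := fun x =>
    e x * (q2 x - 2 * (l * ψ1 x) * q1 x + ((l * ψ1 x) ^ 2 - l * ψ2 x) * q0 x) with hu2
  set u3 : ℝ → ℝ := fun x => e x * (q3 x - 3 * (l * ψ1 x) * q2 x
    + 3 * ((l * ψ1 x) ^ 2 - l * ψ2 x) * q1 x
    + (-(l * ψ1 x) ^ 3 + 3 * (l * ψ1 x) * (l * ψ2 x) - l * ψ3 x) * q0 x) with hu3
  set ut : ℝ → ℝ := fun x => e x * (qt x - l ^ 2 * (κ * ψ x) * q0 x) with hut
  set utx : ℝ → ℝ := fun x => -(l * ψ1 x) * e x * (qt x - l ^ 2 * (κ * ψ x) * q0 x)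
    + e x * (qtx x - l ^ 2 * κ * (ψ1 x * q0 x + ψ x * q1 x)) with hutx
  have ha1d : ∀ x, HasDerivAt a1 (a2 x) x := fun x => (hψ.hasDeriv1 x).const_mul l
  have ha2d : ∀ x, HasDerivAt a2 (l * ψ3 x) x := fun x => (hψ.hasDeriv2 x).const_mul l
  have hu0d : ∀ x, HasDerivAt u0 (u1 x) x := fun x => by
    refine ((hed x).mul (hq0 x)).congr_deriv ?_
    simp only [hu1]
    ring
  have hu1d : ∀ x, HasDerivAt u1 (u2 x) x := fun x => by
    refine ((hed x).mul ((hq1 x).sub ((ha1d x).mul (hq0 x)))).congr_deriv ?_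
    simp only [hu2, ha1, ha2, Pi.sub_apply, Pi.mul_apply]
    ring
  have hu2d : ∀ x, HasDerivAt u2 (u3 x) x := fun x => by
    refine ((hed x).mul (((hq2 x).sub (((ha1d x).const_mul 2).mul (hq1 x))).add
      ((((ha1d x).pow 2).sub (ha2d x)).mul (hq0 x)))).congr_deriv ?_
    simp only [hu3, ha1, ha2, Pi.sub_apply, Pi.mul_apply, Pi.add_apply, Pi.pow_apply]
    push_cast
    ring
  have hutd : ∀ x, HasDerivAt ut (utx x) x := fun x => by
    refine ((hed x).mul ((hqt x).sub ((((hψ.hasDeriv0 x).const_mul κ).const_mul (l ^ 2)).mul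
      (hq0 x)))).congr_deriv ?_
    simp only [hutx, Pi.sub_apply, Pi.mul_apply]
    ring
  set E : ℝ → ℝ := fun x => energy (l * ψ x) (e x * q0 x) (e x * q1 x) (e x * q2 x) with hE
  set P : ℝ → ℝ := fun x => fluxDeriv (a1 x) (a2 x) (l * ψ3 x) (u0 x) (u1 x) (u2 x) (u3 x)
    (ut x) (utx x) with hP
  set D : ℝ → ℝ := fun x => densityDeriv (l * ψ1 x) (l ^ 2 * (κ * ψ1 x)) (u0 x) (u1 x) (ut x)
    (utx x) with hD
  have cE : Continuous E := by
    simp only [hE, energy]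
    fun_prop
  have cP : Continuous P := by
    simp only [hP, fluxDeriv, ha1, ha2, hu0, hu1, hu2, hu3, hut, hutx]
    fun_prop
  have cD : Continuous D := by
    simp only [hD, densityDeriv, hu0, hu1, hut, hutx]
    fun_prop
  have cF : Continuous fun x => 1 / 2 * (e x * (qt x + q3 x)) ^ 2 := by fun_prop
  have hPint : ∫ x in (0:ℝ)..L, P x
      = flux (a1 L) (a2 L) (u0 L) (u1 L) (u2 L) (ut L)
        - flux (a1 0) (a2 0) (u0 0) (u1 0) (u2 0) (ut 0) :=
    intervalIntegral.integral_eq_sub_of_hasDerivAt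
      (fun x _ => hasDerivAt_flux (ha1d x) (ha2d x) (hu0d x) (hu1d x) (hu2d x) (hutd x))
      (cP.intervalIntegrable _ _)
  have hsource : ∀ x, (ut x + l ^ 2 * (κ * ψ x) * u0 x + u3 x + 3 * (l * ψ1 x) * u2 x
      + 3 * (l * ψ2 x + (l * ψ1 x) ^ 2) * u1 x
      + (l * ψ3 x + 3 * (l * ψ1 x) * (l * ψ2 x) + (l * ψ1 x) ^ 3) * u0 x)
      = e x * (qt x + q3 x) := fun x => by
    simp only [hu0, hu1, hu2, hu3, hut]
    ring
  have hκψ : ∀ {y}, |y| ≤ A → |κ * y| ≤ A := fun {y} hy => by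
    rw [abs_mul]
    exact (mul_le_of_le_one_left (abs_nonneg _) hκ).trans hy
  have hEu : ∀ x ∈ Icc 0 L, E x ≤ compConst A δ * energy l (u0 x) (u1 x) (u2 x) := fun x hx =>
    energy_le_conj hA hδ hl1' (hψ.lower x hx) (hψ.bound1 x hx) (hψ.bound2 x hx)
      ((le_abs_self _).trans (hψ.bound0 x hx)) _ _ _ _
  have huE : ∀ x ∈ Icc 0 L, energy l (u0 x) (u1 x) (u2 x) ≤ compConst A δ * E x := fun x hx =>
    conj_le_energy hA hδ hl1' (hψ.lower x hx) (hψ.bound1 x hx) (hψ.bound2 x hx) hδ1 _ _ _ _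
  have hcEu : ∀ x ∈ Icc 0 L, coerConst A δ * E x ≤ δ ^ 5 * energy l (u0 x) (u1 x) (u2 x) :=
    fun x hx => by
      unfold coerConst
      rw [div_mul_eq_mul_div, div_le_iff₀ hK, mul_assoc]
      refine mul_le_mul_of_nonneg_left ?_ (by positivity)
      rw [mul_comm]
      linarith [hEu x hx]
  have hEn : ∀ x, 0 ≤ energy l (u0 x) (u1 x) (u2 x) := fun x => energy_nonneg hl0.le _ _ _
  have hmain := integral_add_le_of_subinterval (G := fun x => P x + D x)
    (F := fun x => 1 / 2 * (e x * (qt x + q3 x)) ^ 2) (E := E) (c := coerConst A δ)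
    (C := obsConst A δ) hl1 hl12 hl2 (cP.add cD) cF cE
    (fun x hx hxo => by
      have h := carleman_coercive (u0 := u0 x) (u1 := u1 x) (u2 := u2 x) (u3 := u3 x) (ut := ut x)
        (utx := utx x) hA hδ hδ1 hl (hψ.bound1 x hx) (hψ.bound2 x hx) (hψ.bound3 x hx)
        (hκψ (hψ.bound0 x hx)) (hκψ (hψ.bound1 x hx)) (hψ.slope x hx hxo) (hψ.concave x hx hxo)
      rw [hsource x] at h
      have := mul_nonneg (show 0 ≤ δ ^ 5 by positivity) (hEn x)
      simp only [hP, hD, ha1, ha2]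
      linarith [hcEu x hx])
    (fun x hx => by
      have hx' : x ∈ Icc 0 L := ⟨hl1.trans hx.1, hx.2.trans hl2⟩
      have h := carleman_lower_bound (u0 := u0 x) (u1 := u1 x) (u2 := u2 x) (u3 := u3 x)
        (ut := ut x) (utx := utx x) hA hl1' (hψ.bound1 x hx') (hψ.bound2 x hx')
        (hψ.bound3 x hx') (hκψ (hψ.bound0 x hx')) (hκψ (hψ.bound1 x hx'))
      rw [hsource x] at h
      have h' := mul_le_mul_of_nonneg_left (huE x hx') (show 0 ≤ 21 * A ^ 5 by positivity)
      simp only [hP, hD, ha1, ha2]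
      unfold obsConst
      linarith)
  have m0 : (0 : ℝ) ∈ Icc 0 L := ⟨le_rfl, hL⟩
  have mL : L ∈ Icc 0 L := ⟨hL, le_rfl⟩
  have z0 : u0 0 = 0 := by simp [hu0, h00]
  have zt : ut 0 = 0 := by simp [hut, h00, ht0]
  have w0 : u0 L = 0 := by simp [hu0, h0L]
  have w1 : u1 L = 0 := by simp [hu1, h0L, h1L]
  have hleft : flux (a1 0) (a2 0) (u0 0) (u1 0) (u2 0) (ut 0)
      ≤ -(coerConst A δ * energy (l * ψ 0) 0 (e 0 * q1 0) (e 0 * q2 0)) := by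
    have h := hcEu 0 m0
    have hE0 : E 0 = energy (l * ψ 0) 0 (e 0 * q1 0) (e 0 * q2 0) := by simp [hE, h00]
    rw [hE0] at h
    rw [z0] at h ⊢
    rw [zt]
    have := flux_left_le (u1 := u1 0) (u2 := u2 0) hA hδ hδ1 hl (hψ.bound2 0 m0) hψ.left
    linarith
  have hright : coerConst A δ * energy (l * ψ L) 0 0 (e L * q2 L)
      ≤ flux (a1 L) (a2 L) (u0 L) (u1 L) (u2 L) (ut L) := by
    have h := hcEu L mL
    have hEL : E L = energy (l * ψ L) 0 0 (e L * q2 L) := by simp [hE, h0L, h1L]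
    rw [hEL] at h
    rw [w0, w1] at h ⊢
    exact h.trans (le_flux_right hδ hδ1 hl0.le hψ.right)
  rw [intervalIntegral.integral_add (cP.intervalIntegrable _ _) (cD.intervalIntegrable _ _),
    hPint, intervalIntegral.integral_const_mul] at hmain
  linarith

end FixedTime

section Time

/-- The functions of time and space that agree on `(0, T) × [0, L]` with a continuous function
vanishing at the times `0` and `T`. -/
def IsTame (T L : ℝ) (F : ℝ → ℝ → ℝ) : Prop :=
  ∃ G : ℝ → ℝ → ℝ, (Continuous fun p : ℝ × ℝ => G p.1 p.2) ∧
    (∀ t ∈ Ioo 0 T, ∀ x ∈ Icc 0 L, F t x = G t x) ∧ (∀ x, G 0 x = 0) ∧ ∀ x, G T x = 0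

lemma IsTame.add {T L : ℝ} {F₁ F₂ : ℝ → ℝ → ℝ} (h₁ : IsTame T L F₁) (h₂ : IsTame T L F₂) :
    IsTame T L fun t x => F₁ t x + F₂ t x := by
  obtain ⟨G₁, c₁, e₁, z₁, w₁⟩ := h₁
  obtain ⟨G₂, c₂, e₂, z₂, w₂⟩ := h₂
  exact ⟨fun t x => G₁ t x + G₂ t x, c₁.add c₂,
    fun t ht x hx => by simp only [e₁ t ht x hx, e₂ t ht x hx],
    fun x => by simp [z₁, z₂], fun x => by simp [w₁, w₂]⟩

lemma continuous_inv_pow_mul_expNegInvGlue (k : ℕ) :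
    Continuous fun y : ℝ => y⁻¹ ^ k * expNegInvGlue y := by
  simpa using expNegInvGlue.continuous_polynomial_eval_inv_mul (Polynomial.X ^ k)

lemma isTame_mul_exp {T L s : ℝ} (hL : 0 ≤ L) (hs : 0 < s) {ψ : ℝ → ℝ} (hψ : Continuous ψ)
    (hpos : ∀ x ∈ Icc 0 L, 0 < ψ x) (k : ℕ) {c : ℝ → ℝ → ℝ}
    (hc : Continuous fun p : ℝ × ℝ => c p.1 p.2) :
    IsTame T L fun t x =>
      c t x * ((t * (T - t))⁻¹ ^ k * Real.exp (-(s * (t * (T - t))⁻¹ * ψ x)) ^ 2) := by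
  set η : ℝ → ℝ := fun x => 2 * s * ψ (projIcc 0 L hL x) with hη
  have hηc : Continuous η := by
    have := hψ.comp (continuous_subtype_val.comp (continuous_projIcc (h := hL)))
    exact continuous_const.mul this
  have hηpos : ∀ x, 0 < η x := fun x => by
    have := hpos _ (projIcc 0 L hL x).2
    positivity
  set y : ℝ × ℝ → ℝ := fun p => p.1 * (T - p.1) / η p.2 with hy
  have hyc : Continuous y := by
    refine Continuous.div (by fun_prop) (by fun_prop) fun p => (hηpos _).ne'
  refine ⟨fun t x => c t x * ((η x)⁻¹ ^ k * ((y (t, x))⁻¹ ^ k * expNegInvGlue (y (t, x)))),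
    ?_, ?_, ?_, ?_⟩
  · have h1 : Continuous fun p : ℝ × ℝ => (η p.2)⁻¹ ^ k :=
      ((hηc.comp continuous_snd).inv₀ fun p => (hηpos _).ne').pow k
    exact hc.mul (h1.mul ((continuous_inv_pow_mul_expNegInvGlue k).comp hyc))
  · intro t ht x hx
    have hτ : 0 < t * (T - t) := mul_pos ht.1 (by linarith [ht.2])
    have hηx : η x = 2 * s * ψ x := by simp only [hη, projIcc_of_mem hL hx]
    have hη0 := hηpos x
    have hy0 : 0 < y (t, x) := div_pos hτ hη0
    have hyinv : (y (t, x))⁻¹ = η x * (t * (T - t))⁻¹ := by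
      simp only [hy, inv_div]
      rw [div_eq_mul_inv]
    have hexp : Real.exp (-(s * (t * (T - t))⁻¹ * ψ x)) ^ 2 = expNegInvGlue (y (t, x)) := by
      rw [expNegInvGlue, if_neg (not_le.2 hy0), hyinv, hηx, ← Real.exp_nat_mul]
      congr 1
      push_cast
      ring
    beta_reduce
    rw [hexp, hyinv, mul_pow, ← mul_assoc ((η x)⁻¹ ^ k), ← mul_assoc ((η x)⁻¹ ^ k), ← mul_pow,
      inv_mul_cancel₀ hη0.ne', one_pow, one_mul]
  · intro x
    simp [hy, expNegInvGlue.zero]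
  · intro x
    simp [hy, expNegInvGlue.zero]

lemma IsTame.exists_continuous_integral {T L a b : ℝ} {F : ℝ → ℝ → ℝ} (h : IsTame T L F)
    (ha : 0 ≤ a) (hab : a ≤ b) (hb : b ≤ L) :
    ∃ g : ℝ → ℝ, Continuous g ∧ (∀ t ∈ Ioo 0 T, ∫ x in a..b, F t x = g t) ∧ g 0 = 0 ∧ g T = 0 := by
  obtain ⟨G, hG, he, h0, hT⟩ := h
  refine ⟨fun t => ∫ x in a..b, G t x,
    intervalIntegral.continuous_parametric_intervalIntegral_of_continuous' hG a b, ?_,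
    by simp [h0], by simp [hT]⟩
  intro t ht
  refine intervalIntegral.integral_congr fun x hx => ?_
  rw [uIcc_of_le hab] at hx
  exact he t ht x ⟨ha.trans hx.1, hx.2.trans hb⟩

lemma integrableOn_Icc_of_eqOn_Ioo {T : ℝ} {f g : ℝ → ℝ} (hg : Continuous g)
    (h : ∀ t ∈ Ioo 0 T, f t = g t) : IntegrableOn f (Icc 0 T) := by
  rw [integrableOn_Icc_iff_integrableOn_Ioo]
  exact ((hg.integrableOn_Icc (a := 0) (b := T)).mono_set Ioo_subset_Icc_self).congr_fun
    (fun t ht => (h t ht).symm) measurableSet_Ioo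

lemma IsTame.integrableOn_integral {T L a b : ℝ} {F : ℝ → ℝ → ℝ} (h : IsTame T L F)
    (ha : 0 ≤ a) (hab : a ≤ b) (hb : b ≤ L) :
    IntegrableOn (fun t => ∫ x in a..b, F t x) (Icc 0 T) := by
  obtain ⟨g, hg, he, -⟩ := h.exists_continuous_integral ha hab hb
  exact integrableOn_Icc_of_eqOn_Ioo hg he

lemma IsTame.integrableOn_apply {T L x : ℝ} {F : ℝ → ℝ → ℝ} (h : IsTame T L F)
    (hx : x ∈ Icc 0 L) : IntegrableOn (fun t => F t x) (Icc 0 T) := by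
  obtain ⟨G, hG, he, -⟩ := h
  exact integrableOn_Icc_of_eqOn_Ioo (g := fun t => G t x) (by fun_prop) fun t ht => he t ht x hx

lemma IsTame.continuousOn_integral {T L : ℝ} {F : ℝ → ℝ → ℝ} (h : IsTame T L F) (hL : 0 ≤ L)
    (h0 : ∀ x, F 0 x = 0) (hT : ∀ x, F T x = 0) :
    ContinuousOn (fun t => ∫ x in (0:ℝ)..L, F t x) (Icc 0 T) := by
  obtain ⟨g, hg, he, hg0, hgT⟩ := h.exists_continuous_integral le_rfl hL le_rfl
  refine hg.continuousOn.congr fun t ht => ?_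
  rcases eq_or_lt_of_le ht.1 with h | h
  · simp [← h, h0, hg0]
  rcases eq_or_lt_of_le ht.2 with h' | h'
  · simp [h', hT, hgT]
  exact he t ⟨h, h'⟩

lemma hasDerivAt_inv_mul_sub {T t : ℝ} (ht : t ∈ Ioo 0 T) :
    HasDerivAt (fun r => (r * (T - r))⁻¹) (-(T - 2 * t) * (t * (T - t))⁻¹ ^ 2) t := by
  have hτ : t * (T - t) ≠ 0 := (mul_pos ht.1 (by linarith [ht.2])).ne'
  have h : HasDerivAt (fun r : ℝ => r * (T - r)) (T - 2 * t) t := by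
    refine ((hasDerivAt_id t).mul ((hasDerivAt_id t).const_sub T)).congr_deriv ?_
    simp only [id]
    ring
  refine (h.inv hτ).congr_deriv ?_
  rw [inv_pow, div_eq_mul_inv]

/-- The Carleman estimate with energies written in the conjugated variables. -/
lemma carleman_estimate {A δ T L l1 l2 s : ℝ} {ψ ψ1 ψ2 ψ3 : ℝ → ℝ}
    (hψ : WeightBounds A δ L l1 l2 ψ ψ1 ψ2 ψ3) (hT : 0 < T) (hl1 : 0 ≤ l1) (hl12 : l1 ≤ l2)
    (hl2 : l2 ≤ L) (hsT : T ≤ s) (hs : 12 * A ^ 3 / δ ^ 5 * T ^ 2 ≤ s)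
    {q : ℝ → ℝ → ℝ} (hq : ContDiff ℝ (⊤ : ℕ∞) (Function.uncurry q))
    (hbc : ∀ t ∈ Icc (0:ℝ) T, q t 0 = 0 ∧ q t L = 0 ∧ pdx q t L = 0)
    {θ : ℝ → ℝ} (hθ : θ = fun t => (t * (T - t))⁻¹)
    {e : ℝ → ℝ → ℝ} (he : e = fun t x => Real.exp (-(s * θ t * ψ x))) :
    coerConst A δ * ((∫ t in (0:ℝ)..T, ∫ x in (0:ℝ)..L, energy (s * θ t * ψ x) (e t x * q t x)
          (e t x * pdx q t x) (e t x * pdx (pdx q) t x))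
        + (∫ t in (0:ℝ)..T, energy (s * θ t * ψ 0) 0 (e t 0 * pdx q t 0)
            (e t 0 * pdx (pdx q) t 0))
        + ∫ t in (0:ℝ)..T, energy (s * θ t * ψ L) 0 0 (e t L * pdx (pdx q) t L)) ≤
      1 / 2 * (∫ t in (0:ℝ)..T, ∫ x in (0:ℝ)..L,
          (e t x * (pdt q t x + pdx (pdx (pdx q)) t x)) ^ 2)
        + obsConst A δ * ∫ t in (0:ℝ)..T, ∫ x in l1..l2, energy (s * θ t * ψ x) (e t x * q t x)
          (e t x * pdx q t x) (e t x * pdx (pdx q) t x) := by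
  have hL : 0 ≤ L := by linarith
  have hs0 : 0 < s := by linarith
  have hx1 := contDiff_pdx hq
  have hx2 := contDiff_pdx hx1
  have hx3 := contDiff_pdx hx2
  have hpt := contDiff_pdt hq
  have hptx := contDiff_pdx hpt
  have c0 : Continuous fun p : ℝ × ℝ => q p.1 p.2 := hq.continuous
  have c1 : Continuous fun p : ℝ × ℝ => pdx q p.1 p.2 := hx1.continuous
  have c2 : Continuous fun p : ℝ × ℝ => pdx (pdx q) p.1 p.2 := hx2.continuous
  have c3 : Continuous fun p : ℝ × ℝ => pdx (pdx (pdx q)) p.1 p.2 := hx3.continuous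
  have ct : Continuous fun p : ℝ × ℝ => pdt q p.1 p.2 := hpt.continuous
  have ctx : Continuous fun p : ℝ × ℝ => pdx (pdt q) p.1 p.2 := hptx.continuous
  have d0 : Continuous ψ := continuous_iff_continuousAt.2 fun x => (hψ.hasDeriv0 x).continuousAt
  have d1 : Continuous ψ1 := continuous_iff_continuousAt.2 fun x => (hψ.hasDeriv1 x).continuousAt
  have hψpos : ∀ x ∈ Icc 0 L, 0 < ψ x := fun x hx => hψ.pos.trans_le (hψ.lower x hx)
  have tame : ∀ (k : ℕ) {c : ℝ → ℝ → ℝ}, (Continuous fun p : ℝ × ℝ => c p.1 p.2) →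
      IsTame T L fun t x => c t x * (θ t ^ k * e t x ^ 2) := fun k c hc => by
    rw [he, hθ]
    exact isTame_mul_exp hL hs0 d0 hψpos k hc
  have tameE : IsTame T L fun t x => energy (s * θ t * ψ x) (e t x * q t x)
      (e t x * pdx q t x) (e t x * pdx (pdx q) t x) := by
    convert ((tame 1 (c := fun t x => s * ψ x * pdx (pdx q) t x ^ 2) (by fun_prop)).add
      (tame 3 (c := fun t x => (s * ψ x) ^ 3 * pdx q t x ^ 2) (by fun_prop))).add
      (tame 5 (c := fun t x => (s * ψ x) ^ 5 * q t x ^ 2) (by fun_prop)) using 3 with t x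
    unfold energy
    ring
  have tameF : IsTame T L fun t x =>
      (e t x * (pdt q t x + pdx (pdx (pdx q)) t x)) ^ 2 := by
    convert tame 0 (c := fun t x => (pdt q t x + pdx (pdx (pdx q)) t x) ^ 2) (by fun_prop)
      using 3 with t x
    ring
  set Dn : ℝ → ℝ → ℝ := fun t x => density (s * θ t * ψ1 x) (e t x * q t x)
    (e t x * (pdx q t x - s * θ t * ψ1 x * q t x)) with hDn
  have tameD : IsTame T L Dn := by
    convert ((tame 1 (c := fun t x => -3 / 2 * (s * ψ1 x) * pdx q t x ^ 2) (by fun_prop)).add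
      (tame 2 (c := fun t x => 3 * (s * ψ1 x) ^ 2 * q t x * pdx q t x) (by fun_prop))).add
      (tame 3 (c := fun t x => -(s * ψ1 x) ^ 3 * q t x ^ 2) (by fun_prop)) using 3 with t x
    simp only [hDn, density]
    ring
  set κ : ℝ → ℝ := fun t => -(T - 2 * t) / s with hκ
  set Dt : ℝ → ℝ → ℝ := fun t x =>
    densityDeriv (s * θ t * ψ1 x) ((s * θ t) ^ 2 * (κ t * ψ1 x)) (e t x * q t x)
      (e t x * (pdx q t x - s * θ t * ψ1 x * q t x))
      (e t x * (pdt q t x - (s * θ t) ^ 2 * (κ t * ψ x) * q t x))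
      (-(s * θ t * ψ1 x) * e t x * (pdt q t x - (s * θ t) ^ 2 * (κ t * ψ x) * q t x)
        + e t x * (pdx (pdt q) t x - (s * θ t) ^ 2 * κ t * (ψ1 x * q t x + ψ x * pdx q t x)))
    with hDt
  have hθc : ContinuousOn θ (Ioo 0 T) := fun t ht => by
    rw [hθ]
    exact (hasDerivAt_inv_mul_sub ht).continuousAt.continuousWithinAt
  have hDt_cont : ContinuousOn (Function.uncurry Dt) (Ioo 0 T ×ˢ univ) := by
    have hθc' : ContinuousOn (fun p : ℝ × ℝ => θ p.1) (Ioo 0 T ×ˢ univ) :=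
      hθc.comp continuousOn_fst fun p hp => hp.1
    have hκc : Continuous κ := by
      simp only [hκ]
      fun_prop
    obtain ⟨Θ, hΘ⟩ : ∃ Θ : ℝ × ℝ → ℝ, ∀ p, Θ p = θ p.1 := ⟨_, fun _ => rfl⟩
    obtain ⟨E, hE⟩ : ∃ E : ℝ × ℝ → ℝ, ∀ p, E p = e p.1 p.2 := ⟨_, fun _ => rfl⟩
    have hΘc : ContinuousOn Θ (Ioo 0 T ×ˢ univ) := by simpa only [← hΘ] using hθc'
    have hEc : ContinuousOn E (Ioo 0 T ×ˢ univ) := by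
      have : E = fun p => Real.exp (-(s * Θ p * ψ p.2)) := by
        funext p
        rw [hE, hΘ, he]
      rw [this]
      fun_prop
    simp only [hDt, densityDeriv, Function.uncurry_def, ← hΘ, ← hE]
    fun_prop
  have hDeriv : ∀ t ∈ Ioo 0 T, ∀ x, HasDerivAt (fun r => Dn r x) (Dt t x) t := by
    intro t ht x
    have hθd : HasDerivAt (fun r => s * θ r) ((s * θ t) ^ 2 * κ t) t := by
      rw [hθ]
      refine ((hasDerivAt_inv_mul_sub ht).const_mul s).congr_deriv ?_
      simp only [hκ]
      field_simp
    have hed : HasDerivAt (fun r => e r x) (-((s * θ t) ^ 2 * (κ t * ψ x)) * e t x) t := by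
      rw [he]
      refine ((hθd.mul_const (ψ x)).neg.exp).congr_deriv ?_
      simp only [Pi.neg_apply]
      ring
    have ha1 : HasDerivAt (fun r => s * θ r * ψ1 x) ((s * θ t) ^ 2 * (κ t * ψ1 x)) t :=
      (hθd.mul_const (ψ1 x)).congr_deriv (by ring)
    have h0 := hasDerivAt_pdt hq t x
    have h1 := hasDerivAt_pdt hx1 t x
    rw [pdt_pdx_comm hq] at h1
    refine hasDerivAt_density ha1 ((hed.mul h0).congr_deriv ?_)
      ((hed.mul (h1.sub (ha1.mul h0))).congr_deriv ?_)
    · ring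
    · simp only [Pi.sub_apply, Pi.mul_apply]
      ring
  have hDn_cont : ∀ t, Continuous (Dn t) := fun t => by
    simp only [hDn, density, he]
    fun_prop
  have hEderiv : ∀ t ∈ Ioo 0 T, HasDerivAt (fun r => ∫ x in (0:ℝ)..L, Dn r x)
      (∫ x in (0:ℝ)..L, Dt t x) t := fun t ht =>
    hasDerivAt_intervalIntegral_of_continuousOn isOpen_Ioo ht (fun τ _ => hDn_cont τ)
      hDt_cont hDeriv
  have hDn0 : ∀ x, Dn 0 x = 0 := fun x => by simp [hDn, density, hθ]
  have hDnT : ∀ x, Dn T x = 0 := fun x => by simp [hDn, density, hθ]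
  have hintE := tameE.integrableOn_integral le_rfl hL le_rfl
  have hintO := tameE.integrableOn_integral hl1 hl12 hl2
  have hintF := tameF.integrableOn_integral le_rfl hL le_rfl
  have hint0 : IntegrableOn (fun t => energy (s * θ t * ψ 0) 0 (e t 0 * pdx q t 0)
      (e t 0 * pdx (pdx q) t 0)) (Icc 0 T) :=
    (tameE.integrableOn_apply (left_mem_Icc.2 hL)).congr_fun
      (fun t ht => by simp [(hbc t ht).1]) measurableSet_Icc
  have hintL : IntegrableOn (fun t => energy (s * θ t * ψ L) 0 0
      (e t L * pdx (pdx q) t L)) (Icc 0 T) :=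
    (tameE.integrableOn_apply (right_mem_Icc.2 hL)).congr_fun
      (fun t ht => by simp [(hbc t ht).2.1, (hbc t ht).2.2]) measurableSet_Icc
  have intervalInt : ∀ {f : ℝ → ℝ}, IntegrableOn f (Icc 0 T) → IntervalIntegrable f volume 0 T :=
    fun h => (intervalIntegrable_iff_integrableOn_Icc_of_le hT.le).2 h
  have key := intervalIntegral.sub_le_integral_of_hasDeriv_right_of_le hT.le
    (tameD.continuousOn_integral hL hDn0 hDnT)
    (fun t ht => (hEderiv t ht).hasDerivWithinAt)
    (((hintF.const_mul (1 / 2)).add (hintO.const_mul (obsConst A δ))).sub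
      (((hintE.add hint0).add hintL).const_mul (coerConst A δ)))
    (fun t ht => by
      have hτ : 0 < t * (T - t) := mul_pos ht.1 (by linarith [ht.2])
      have hl : 12 * A ^ 3 / δ ^ 5 ≤ s * θ t := by
        rw [hθ, ← div_eq_mul_inv, le_div_iff₀ hτ]
        refine le_trans ?_ hs
        have := hψ.one_le
        have := hψ.pos
        gcongr
        nlinarith [ht.1, ht.2]
      have hκ1 : |κ t| ≤ 1 := by
        rw [hκ, abs_div, abs_neg, abs_of_pos hs0, div_le_one hs0, abs_le]
        constructor <;> linarith [ht.1, ht.2]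
      have hb := hbc t (Ioo_subset_Icc_self ht)
      have ht0 : pdt q t 0 = 0 := by
        have : (fun r => q r 0) =ᶠ[𝓝 t] fun _ => (0 : ℝ) := by
          filter_upwards [isOpen_Ioo.mem_nhds ht] with r hr
          exact (hbc r (Ioo_subset_Icc_self hr)).1
        exact this.deriv_eq.trans (deriv_const _ _)
      have := fixed_time_estimate hψ hl1 hl12 hl2 hl hκ1 (q0 := q t) (q1 := pdx q t)
        (q2 := pdx (pdx q) t) (q3 := pdx (pdx (pdx q)) t) (qt := pdt q t) (qtx := pdx (pdt q) t)
        (hasDerivAt_pdx hq t) (hasDerivAt_pdx hx1 t) (hasDerivAt_pdx hx2 t)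
        (hasDerivAt_pdx hpt t) (by fun_prop) (by fun_prop) hb.1 ht0 hb.2.1 hb.2.2
        (e := e t) (by rw [he])
      simp only [Pi.add_apply, Pi.sub_apply]
      linarith)
  simp only [hDn0, hDnT, intervalIntegral.integral_zero, sub_zero] at key
  simp only [Pi.add_apply, Pi.sub_apply] at key
  rw [intervalIntegral.integral_sub, intervalIntegral.integral_add,
    intervalIntegral.integral_const_mul, intervalIntegral.integral_const_mul,
    intervalIntegral.integral_const_mul, intervalIntegral.integral_add,
    intervalIntegral.integral_add] at key
  · linarith
  · exact intervalInt hintE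
  · exact intervalInt hint0
  · exact intervalInt (hintE.add hint0)
  · exact intervalInt hintL
  · exact (intervalInt hintF).const_mul _
  · exact (intervalInt hintO).const_mul _
  · exact ((intervalInt hintF).const_mul _).add ((intervalInt hintO).const_mul _)
  · exact (intervalInt ((hintE.add hint0).add hintL)).const_mul _

end Time

section Weight

lemma exists_bound_of_continuous {L : ℝ} {f : ℝ → ℝ} (hf : Continuous f) :
    ∃ A, 1 ≤ A ∧ ∀ x ∈ Icc 0 L, |f x| ≤ A := by
  obtain ⟨A, hA⟩ := isCompact_Icc.exists_bound_of_continuousOn (s := Icc 0 L) hf.continuousOn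
  exact ⟨max 1 A, le_max_left _ _, fun x hx => (hA x hx).trans (le_max_right _ _)⟩

lemma exists_pos_le_of_continuous {K : Set ℝ} (hK : IsCompact K) {f : ℝ → ℝ} (hf : Continuous f)
    (hpos : ∀ x ∈ K, 0 < f x) : ∃ δ, 0 < δ ∧ ∀ x ∈ K, δ ≤ f x := by
  rcases K.eq_empty_or_nonempty with rfl | hne
  · exact ⟨1, one_pos, by simp⟩
  obtain ⟨x, hx, hmin⟩ := hK.exists_isMinOn hne hf.continuousOn
  exact ⟨f x, hpos x hx, fun y hy => hmin hy⟩

lemma exists_weightBounds {L l1 l2 : ℝ} (hl1 : 0 ≤ l1) (hl12 : l1 ≤ l2) (hl2 : l2 ≤ L) {ψ : ℝ → ℝ}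
    (hψ : ContDiff ℝ 3 ψ) (hpos : ∀ x ∈ Icc 0 L, 0 < ψ x)
    (hout : ∀ x ∈ Icc 0 L, x ∉ Ioo l1 l2 → deriv ψ x ≠ 0 ∧ deriv (deriv ψ) x < 0)
    (hleft : deriv ψ 0 < 0) (hright : 0 < deriv ψ L) :
    ∃ A δ, WeightBounds A δ L l1 l2 ψ (deriv ψ) (deriv (deriv ψ)) (deriv (deriv (deriv ψ))) := by
  have hL : 0 ≤ L := by linarith
  have h1 : ContDiff ℝ 2 (deriv ψ) := hψ.deriv' (n := 2)
  have h2 : ContDiff ℝ 1 (deriv (deriv ψ)) := h1.deriv' (n := 1)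
  have h3 : ContDiff ℝ 0 (deriv (deriv (deriv ψ))) := h2.deriv' (n := 0)
  obtain ⟨A0, hA0, b0⟩ := exists_bound_of_continuous (L := L) hψ.continuous
  obtain ⟨A1, hA1, b1⟩ := exists_bound_of_continuous (L := L) h1.continuous
  obtain ⟨A2, hA2, b2⟩ := exists_bound_of_continuous (L := L) h2.continuous
  obtain ⟨A3, hA3, b3⟩ := exists_bound_of_continuous (L := L) h3.continuous
  have hK : IsCompact (Icc 0 L ∩ (Ioo l1 l2)ᶜ) :=
    isCompact_Icc.inter_right isOpen_Ioo.isClosed_compl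
  obtain ⟨δ0, hδ0, m0⟩ := exists_pos_le_of_continuous isCompact_Icc hψ.continuous hpos
  obtain ⟨δ1, hδ1, m1⟩ := exists_pos_le_of_continuous hK h1.continuous.abs
    fun x hx => abs_pos.2 (hout x hx.1 hx.2).1
  obtain ⟨δ2, hδ2, m2⟩ := exists_pos_le_of_continuous hK h2.continuous.neg
    fun x hx => neg_pos.2 (hout x hx.1 hx.2).2
  have hδ : min 1 (min δ0 (min δ1 δ2)) ≤ δ1 :=
    (min_le_right _ _).trans ((min_le_right _ _).trans (min_le_left _ _))
  refine ⟨A0 + A1 + A2 + A3, min 1 (min δ0 (min δ1 δ2)), by linarith, by positivity,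
    min_le_left _ _, fun x => (hψ.differentiable (by norm_num) x).hasDerivAt,
    fun x => (h1.differentiable (by norm_num) x).hasDerivAt,
    fun x => (h2.differentiable (by norm_num) x).hasDerivAt, h3.continuous,
    fun x hx => ((min_le_right _ _).trans (min_le_left _ _)).trans (m0 x hx),
    fun x hx => (b0 x hx).trans (by linarith), fun x hx => (b1 x hx).trans (by linarith),
    fun x hx => (b2 x hx).trans (by linarith), fun x hx => (b3 x hx).trans (by linarith),
    fun x hx hx' => hδ.trans (m1 x ⟨hx, hx'⟩), fun x hx hx' => ?_, ?_, ?_⟩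
  · exact le_neg.1 (((min_le_right _ _).trans
      ((min_le_right _ _).trans (min_le_right _ _))).trans (m2 x ⟨hx, hx'⟩))
  · have := m1 0 ⟨left_mem_Icc.2 hL, fun h => h.1.not_ge hl1⟩
    rw [abs_of_neg hleft] at this
    linarith
  · have := m1 L ⟨right_mem_Icc.2 hL, fun h => h.2.not_ge hl2⟩
    rw [abs_of_pos hright] at this
    linarith

end Weight

end KdVCarleman

/-- Carleman estimate for the linear KdV operator
`q ↦ q_t + q_xxx` with internal observation on `ω = (l1,l2)`, with weight
`φ(t,x) = ψ(x)/(t(T−t))` built from `(ψ, l3)` satisfying (C1)–(C5). -/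
theorem stmt_3 (T L l1 l2 : ℝ) (hT : 0 < T) (hl1 : 0 < l1) (hl12 : l1 < l2) (hl2 : l2 < L)
    (ψ : ℝ → ℝ) (l3 : ℝ) (hψ : ContDiff ℝ 3 ψ) (hl3 : l3 ∈ Set.Ioo l1 l2)
    (hC1 : ∀ x ∈ Set.Icc (0:ℝ) L, 0 < ψ x)
    (hC2 : ∀ x ∈ Set.Icc (0:ℝ) L, x ∉ Set.Ioo l1 l2 →
      deriv ψ x ≠ 0 ∧ deriv (deriv ψ) x < 0 ∧
        deriv ψ x * deriv (deriv (deriv ψ)) x < 0)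
    (hC3a : deriv ψ 0 < 0) (hC3b : 0 < deriv ψ L)
    (hC4min : ∀ x ∈ Set.Icc l1 l2, ψ l3 ≤ ψ x)
    (hC4max : ∀ x ∈ Set.Icc l1 l2, ψ x ≤ ψ l1)
    (hC4lt : ψ l3 < ψ l1) (hC4eq : ψ l1 = ψ l2)
    (hC4glob : ∀ x ∈ Set.Icc (0:ℝ) L, ψ x ≤ ψ 0) (hC4eq' : ψ 0 = ψ L)
    (hC5 : ψ 0 < (4 / 3) * ψ l3)
    (φ : ℝ → ℝ → ℝ) (hφ : φ = fun t x => ψ x / (t * (T - t))) :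
    ∃ C s0 : ℝ, 0 < C ∧ 0 < s0 ∧
      ∀ s ≥ s0, ∀ q : ℝ → ℝ → ℝ, ContDiff ℝ (⊤ : ℕ∞) (Function.uncurry q) →
        (∀ t ∈ Set.Icc (0:ℝ) T, q t 0 = 0 ∧ q t L = 0 ∧ pdx q t L = 0) →
        (∫ t in (0:ℝ)..T, ∫ x in (0:ℝ)..L,
            (s * φ t x * (pdx (pdx q) t x) ^ 2 + (s * φ t x) ^ 3 * (pdx q t x) ^ 2
              + (s * φ t x) ^ 5 * (q t x) ^ 2) * Real.exp (-2 * s * φ t x))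
          + (∫ t in (0:ℝ)..T,
              (s * φ t 0 * (pdx (pdx q) t 0) ^ 2 + (s * φ t 0) ^ 3 * (pdx q t 0) ^ 2)
                * Real.exp (-2 * s * φ t 0))
          + (∫ t in (0:ℝ)..T,
              s * φ t L * (pdx (pdx q) t L) ^ 2 * Real.exp (-2 * s * φ t L)) ≤
        C * ((∫ t in (0:ℝ)..T, ∫ x in (0:ℝ)..L,
                (pdt q t x + pdx (pdx (pdx q)) t x) ^ 2 * Real.exp (-2 * s * φ t x))
              + ∫ t in (0:ℝ)..T, ∫ x in l1..l2,
                  (s * φ t x * (pdx (pdx q) t x) ^ 2 + (s * φ t x) ^ 3 * (pdx q t x) ^ 2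
                    + (s * φ t x) ^ 5 * (q t x) ^ 2) * Real.exp (-2 * s * φ t x)) := by
  subst hφ
  obtain ⟨A, δ, hw⟩ := KdVCarleman.exists_weightBounds hl1.le hl12.le hl2.le hψ hC1
    (fun x hx hx' => ⟨(hC2 x hx hx').1, (hC2 x hx hx').2.1⟩) hC3a hC3b
  have hA : 0 < A := zero_lt_one.trans_le hw.one_le
  have hδ := hw.pos
  have hc := KdVCarleman.coerConst_pos hw.one_le hδ
  have ho := KdVCarleman.obsConst_pos hw.one_le hδ
  have hr : 0 < 12 * A ^ 3 / δ ^ 5 * T ^ 2 := by positivity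
  refine ⟨(1 / 2 + KdVCarleman.obsConst A δ) / KdVCarleman.coerConst A δ,
    T + 12 * A ^ 3 / δ ^ 5 * T ^ 2, by positivity, by positivity, fun s hs q hq hbc => ?_⟩
  have key := KdVCarleman.carleman_estimate hw hT hl1.le hl12.le hl2.le (by linarith)
    (by linarith) hq hbc (s := s) (θ := fun t => (t * (T - t))⁻¹) rfl rfl
  have hsq : ∀ t x, Real.exp (-(s * (t * (T - t))⁻¹ * ψ x)) ^ 2
      = Real.exp (-2 * s * (ψ x / (t * (T - t)))) := fun t x => by
    rw [← Real.exp_nat_mul]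
    congr 1
    push_cast
    ring
  have hE : ∀ t x u0 u1 u2, KdVCarleman.energy (s * (t * (T - t))⁻¹ * ψ x)
      (Real.exp (-(s * (t * (T - t))⁻¹ * ψ x)) * u0)
      (Real.exp (-(s * (t * (T - t))⁻¹ * ψ x)) * u1)
      (Real.exp (-(s * (t * (T - t))⁻¹ * ψ x)) * u2)
      = (s * (ψ x / (t * (T - t))) * u2 ^ 2 + (s * (ψ x / (t * (T - t)))) ^ 3 * u1 ^ 2
        + (s * (ψ x / (t * (T - t)))) ^ 5 * u0 ^ 2)
        * Real.exp (-2 * s * (ψ x / (t * (T - t)))) := fun t x u0 u1 u2 => by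
    rw [← hsq, KdVCarleman.energy]
    ring
  have hE1 := fun t x u1 u2 => hE t x 0 u1 u2
  have hE2 := fun t x u2 => hE t x 0 0 u2
  simp only [mul_zero, ne_eq, OfNat.ofNat_ne_zero, not_false_eq_true, zero_pow, add_zero]
    at hE1 hE2
  have hF : 0 ≤ ∫ t in (0:ℝ)..T, ∫ x in (0:ℝ)..L, (pdt q t x + pdx (pdx (pdx q)) t x) ^ 2
      * Real.exp (-2 * s * (ψ x / (t * (T - t)))) :=
    intervalIntegral.integral_nonneg hT.le fun t _ =>
      intervalIntegral.integral_nonneg (by linarith) fun x _ => by positivity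
  have hO : 0 ≤ ∫ t in (0:ℝ)..T, ∫ x in l1..l2,
      (s * (ψ x / (t * (T - t))) * (pdx (pdx q) t x) ^ 2
        + (s * (ψ x / (t * (T - t)))) ^ 3 * (pdx q t x) ^ 2
        + (s * (ψ x / (t * (T - t)))) ^ 5 * (q t x) ^ 2)
      * Real.exp (-2 * s * (ψ x / (t * (T - t)))) :=
    intervalIntegral.integral_nonneg hT.le fun t ht =>
      intervalIntegral.integral_nonneg hl12.le fun x hx => by
        have h1 := hC1 x ⟨hl1.le.trans hx.1, hx.2.trans hl2.le⟩
        have h2 : 0 ≤ t * (T - t) := mul_nonneg ht.1 (by linarith [ht.2])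
        have h3 : 0 ≤ s * (ψ x / (t * (T - t))) :=
          mul_nonneg (by linarith) (div_nonneg h1.le h2)
        positivity
  simp only [hE, hE1, hE2, mul_pow (Real.exp _) _ 2, hsq, mul_comm (Real.exp _) (_ ^ 2)] at key
  beta_reduce
  rw [div_mul_eq_mul_div, le_div_iff₀ hc, mul_comm]
  refine key.trans ?_
  nlinarith only [mul_nonneg ho.le hF, hO]
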